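/- Let j ∈ ℕ, let α satisfy max(0, d-2j-2) < α < d-2j, set γ = α - d + 2j + 1 ∈ (-1,1), let μ ∈ C_c^∞(ℝ^d;ℝ), and write 𝒦 = 𝒦_{μ,α}. Then for all integers p ≥ 2 and ℓ ≥ 0 with p + 2ℓ ≤ j+1 (so that 2j - 2ℓ ≥ j+1 > 0), the following identity holds: ∬ ξ^γ |∇_x^p Δ_γ^ℓ 𝒦|² dx dξ + ∬ ξ^γ |∂_ξ ∇_x^{p-1} Δ_γ^ℓ 𝒦|² dx dξ = (1 - γ/(2j-2ℓ)²) ∬ ξ^γ |∇_x^{p-2} Δ_γ^{ℓ+1} 𝒦|² dx dξ - ∬ ξ^γ |∂_ξ ∇_{(x,ξ)} ∇_x^{p-2} Δ_γ^ℓ 𝒦|² dx dξ, all integrals being over ℝ^d × (0,∞). -/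

import Mathlib

open MeasureTheory

noncomputable section

/-- The operator `Δ_γ f = Δ_{(x,ξ)} f + (γ/ξ) ∂_ξ f` on functions on `ℝ^d × ℝ`
(relevant on the upper half-space `ξ > 0`). -/
noncomputable def dgamma (d : ℕ) (γ : ℝ)
    (f : EuclideanSpace ℝ (Fin d) × ℝ → ℝ)
    (p : EuclideanSpace ℝ (Fin d) × ℝ) : ℝ :=
  (∑ i : Fin d,
      fderiv ℝ (fun q => fderiv ℝ f q (EuclideanSpace.single i 1, 0)) p
        (EuclideanSpace.single i 1, 0))
    + fderiv ℝ (fun q => fderiv ℝ f q (0, 1)) p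
        ((0 : EuclideanSpace ℝ (Fin d)), (1 : ℝ))
    + γ / p.2 * fderiv ℝ f p ((0 : EuclideanSpace ℝ (Fin d)), (1 : ℝ))

/-- The partial derivative `∂_{x_i}` of a function on `ℝ^d × ℝ`. -/
noncomputable def dX (d : ℕ) (i : Fin d) (g : EuclideanSpace ℝ (Fin d) × ℝ → ℝ)
    (p : EuclideanSpace ℝ (Fin d) × ℝ) : ℝ :=
  fderiv ℝ g p (EuclideanSpace.single i 1, 0)

/-- Iterated `x`-partial derivatives along a tuple of coordinate indices. -/
noncomputable def dXIter (d : ℕ) {p : ℕ} (js : Fin p → Fin d)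
    (g : EuclideanSpace ℝ (Fin d) × ℝ → ℝ) : EuclideanSpace ℝ (Fin d) × ℝ → ℝ :=
  (List.ofFn js).foldr (fun i h => dX d i h) g

/-- The partial derivative `∂_ξ` in the extension variable. -/
noncomputable def dxi (d : ℕ) (f : EuclideanSpace ℝ (Fin d) × ℝ → ℝ)
    (p : EuclideanSpace ℝ (Fin d) × ℝ) : ℝ :=
  fderiv ℝ f p ((0 : EuclideanSpace ℝ (Fin d)), (1 : ℝ))

/-- The `d+1` coordinate directions of `ℝ^d × ℝ`. -/
noncomputable def dir (d : ℕ) (i : Fin (d + 1)) : EuclideanSpace ℝ (Fin d) × ℝ :=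
  if h : (i : ℕ) < d then (EuclideanSpace.single (⟨i, h⟩ : Fin d) 1, 0)
  else ((0 : EuclideanSpace ℝ (Fin d)), (1 : ℝ))

/-- The extended potential `𝒦_{μ,β}(x,ξ) = ∫ |(x-y,ξ)|^{-β} μ(y) dy` on the upper
half-space. -/
noncomputable def Kext (d : ℕ) (β : ℝ) (μ : EuclideanSpace ℝ (Fin d) → ℝ)
    (p : EuclideanSpace ℝ (Fin d) × ℝ) : ℝ :=
  ∫ y, (‖p.1 - y‖ ^ 2 + p.2 ^ 2) ^ (-β / 2) * μ y

section

open Set Filter Topology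

/-- The open upper half-space. -/
abbrev upperHalf (d : ℕ) : Set (EuclideanSpace ℝ (Fin d) × ℝ) := {q | 0 < q.2}

/-- The partial derivative `∂_i` on `ℝ^d`. -/
def partialDeriv {d : ℕ} (i : Fin d) (ν : EuclideanSpace ℝ (Fin d) → ℝ) :
    EuclideanSpace ℝ (Fin d) → ℝ :=
  fun y => fderiv ℝ ν y (EuclideanSpace.single i 1)

/-- Smooth compactly supported densities. -/
structure IsTestDensity {d : ℕ} (ν : EuclideanSpace ℝ (Fin d) → ℝ) : Prop where
  contDiff : ContDiff ℝ (⊤ : ℕ∞) ν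
  hasCompactSupport : HasCompactSupport ν

section PotentialCalculus

variable {d : ℕ} {s : ℝ} {ν : EuclideanSpace ℝ (Fin d) → ℝ}

lemma isOpen_upperHalf : IsOpen (upperHalf d) := isOpen_lt continuous_const continuous_snd

lemma IsTestDensity.partialDeriv (hν : IsTestDensity ν) (i : Fin d) :
    IsTestDensity (partialDeriv i ν) where
  contDiff := (hν.contDiff.fderiv_right (m := (⊤ : ℕ∞)) (by simp)).clm_apply contDiff_const
  hasCompactSupport := hν.hasCompactSupport.fderiv_apply ℝ _

lemma IsTestDensity.differentiable (hν : IsTestDensity ν) : Differentiable ℝ ν :=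
  hν.contDiff.differentiable (by simp)

lemma partialDeriv_comm (hν : IsTestDensity ν) (i k : Fin d) :
    partialDeriv i (partialDeriv k ν) = partialDeriv k (partialDeriv i ν) := by
  funext y
  have h1 : ∀ l m : Fin d, partialDeriv l (partialDeriv m ν) y =
      fderiv ℝ (fderiv ℝ ν) y (EuclideanSpace.single l 1) (EuclideanSpace.single m 1) := by
    intro l m
    have hd : DifferentiableAt ℝ (fderiv ℝ ν) y :=
      ((hν.contDiff.fderiv_right (m := (⊤ : ℕ∞)) (by simp)).differentiable (by simp)) y
    unfold partialDeriv
    rw [fderiv_clm_apply hd (differentiableAt_const _)]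
    simp
  rw [h1, h1]
  exact (hν.contDiff.contDiffAt.isSymmSndFDerivAt (by simp; norm_cast)) _ _

lemma sq_dist_pos {q : EuclideanSpace ℝ (Fin d) × ℝ} (hq : 0 < q.2)
    (y : EuclideanSpace ℝ (Fin d)) : 0 < ‖q.1 - y‖ ^ 2 + q.2 ^ 2 := by positivity

lemma hasFDerivAt_kernel {q : EuclideanSpace ℝ (Fin d) × ℝ} (hq : 0 < q.2)
    (y : EuclideanSpace ℝ (Fin d)) :
    HasFDerivAt (fun q : EuclideanSpace ℝ (Fin d) × ℝ => (‖q.1 - y‖ ^ 2 + q.2 ^ 2) ^ (-s / 2))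
      ((-s * (‖q.1 - y‖ ^ 2 + q.2 ^ 2) ^ (-(s + 2) / 2)) •
        ((innerSL ℝ (q.1 - y)).comp (ContinuousLinearMap.fst ℝ _ _) +
          q.2 • ContinuousLinearMap.snd ℝ _ _)) q := by
  have h1 : HasFDerivAt (fun q : EuclideanSpace ℝ (Fin d) × ℝ => q.1 - y)
      (ContinuousLinearMap.fst ℝ _ _) q := hasFDerivAt_fst.sub_const y
  have h2 := (h1.norm_sq.add ((hasFDerivAt_snd (𝕜 := ℝ) (p := q)).pow 2)).rpow_const
    (p := -s / 2) (Or.inl (sq_dist_pos hq y).ne')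
  refine HasFDerivAt.congr_fderiv (f := fun q : EuclideanSpace ℝ (Fin d) × ℝ =>
    (‖q.1 - y‖ ^ 2 + q.2 ^ 2) ^ (-s / 2)) h2 ?_
  refine ContinuousLinearMap.ext fun v => ?_
  rw [show -(s + 2) / 2 = -s / 2 - 1 by ring]
  simp
  ring

lemma hasFDerivAt_kernel_source (x : EuclideanSpace ℝ (Fin d)) {t : ℝ} (ht : 0 < t)
    (y : EuclideanSpace ℝ (Fin d)) :
    HasFDerivAt (fun y => (‖x - y‖ ^ 2 + t ^ 2) ^ (-s / 2))
      ((s * (‖x - y‖ ^ 2 + t ^ 2) ^ (-(s + 2) / 2)) • innerSL ℝ (x - y)) y := by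
  have h1 : HasFDerivAt (fun y : EuclideanSpace ℝ (Fin d) => x - y)
      (-ContinuousLinearMap.id ℝ _) y := (hasFDerivAt_id y).const_sub x
  have h2 := (h1.norm_sq.add_const (t ^ 2)).rpow_const
    (p := -s / 2) (Or.inl (sq_dist_pos (q := (x, t)) ht y).ne')
  refine h2.congr_fderiv (ContinuousLinearMap.ext fun v => ?_)
  rw [show -(s + 2) / 2 = -s / 2 - 1 by ring]
  simp
  ring

lemma continuous_kernel_source (s : ℝ) (x : EuclideanSpace ℝ (Fin d)) {t : ℝ} (ht : 0 < t) :
    Continuous fun y => (‖x - y‖ ^ 2 + t ^ 2) ^ (-s / 2) :=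
  continuous_iff_continuousAt.2 fun y => (hasFDerivAt_kernel_source x ht y).continuousAt

lemma integrable_mul_test {f : EuclideanSpace ℝ (Fin d) → ℝ} (hf : Continuous f)
    (hν : IsTestDensity ν) : Integrable (fun y => f y * ν y) :=
  (hf.mul hν.contDiff.continuous).integrable_of_hasCompactSupport hν.hasCompactSupport.mul_left

lemma hasFDerivAt_Kext (hν : IsTestDensity ν) {q : EuclideanSpace ℝ (Fin d) × ℝ}
    (hq : q ∈ upperHalf d) :
    HasFDerivAt (Kext d s ν)
      (∫ y, ν y • ((-s * (‖q.1 - y‖ ^ 2 + q.2 ^ 2) ^ (-(s + 2) / 2)) •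
        ((innerSL ℝ (q.1 - y)).comp (ContinuousLinearMap.fst ℝ _ ℝ) +
          q.2 • ContinuousLinearMap.snd ℝ (EuclideanSpace ℝ (Fin d)) ℝ))) q ∧
    Integrable (fun y => ν y • ((-s * (‖q.1 - y‖ ^ 2 + q.2 ^ 2) ^ (-(s + 2) / 2)) •
        ((innerSL ℝ (q.1 - y)).comp (ContinuousLinearMap.fst ℝ _ ℝ) +
          q.2 • ContinuousLinearMap.snd ℝ (EuclideanSpace ℝ (Fin d)) ℝ))) := by
  have hq' : 0 < q.2 := hq
  set D : EuclideanSpace ℝ (Fin d) × ℝ → EuclideanSpace ℝ (Fin d) →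
      (EuclideanSpace ℝ (Fin d) × ℝ →L[ℝ] ℝ) := fun q y =>
    (-s * (‖q.1 - y‖ ^ 2 + q.2 ^ 2) ^ (-(s + 2) / 2)) •
        ((innerSL ℝ (q.1 - y)).comp (ContinuousLinearMap.fst ℝ _ ℝ) +
          q.2 • ContinuousLinearMap.snd ℝ (EuclideanSpace ℝ (Fin d)) ℝ) with hD
  have hDc : ContinuousOn (fun z : (EuclideanSpace ℝ (Fin d) × ℝ) × EuclideanSpace ℝ (Fin d) =>
      D z.1 z.2) {z | 0 < z.1.2} := by
    intro z hz
    have hz' : 0 < z.1.2 := hz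
    apply ContinuousAt.continuousWithinAt
    have h0 := (sq_dist_pos hz' z.2).ne'
    have h1 : ContinuousAt (fun z : (EuclideanSpace ℝ (Fin d) × ℝ) × EuclideanSpace ℝ (Fin d) =>
      (‖z.1.1 - z.2‖ ^ 2 + z.1.2 ^ 2) ^ (-(s + 2) / 2)) z := by
      refine ContinuousAt.rpow_const ?_ (Or.inl h0)
      fun_prop
    have h2 : ContinuousAt (fun z : (EuclideanSpace ℝ (Fin d) × ℝ) × EuclideanSpace ℝ (Fin d) =>
      ((innerSL ℝ (z.1.1 - z.2)).comp (ContinuousLinearMap.fst ℝ _ ℝ) +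
          z.1.2 • ContinuousLinearMap.snd ℝ (EuclideanSpace ℝ (Fin d)) ℝ)) z := by
      have : Continuous fun z : (EuclideanSpace ℝ (Fin d) × ℝ) × EuclideanSpace ℝ (Fin d) =>
        innerSL ℝ (z.1.1 - z.2) := (innerSL ℝ).continuous.comp (by fun_prop)
      fun_prop
    exact (continuousAt_const.mul h1).smul h2
  have hmem : Metric.closedBall q (q.2 / 2) ⊆ upperHalf d := by
    intro r hr
    have h1 : dist r.2 q.2 ≤ q.2 / 2 := (le_max_right _ _).trans hr
    rw [Real.dist_eq, abs_le] at h1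
    change 0 < r.2
    linarith
  obtain ⟨M, hM⟩ := ((isCompact_closedBall q (q.2 / 2)).prod
    hν.hasCompactSupport.isCompact).exists_bound_of_continuousOn
    (hDc.mono fun z hz => hmem hz.1)
  have hint : ∀ r ∈ upperHalf d, Continuous fun y => D r y := fun r hr =>
    continuousOn_univ.1 (hDc.comp (f := fun y => (r, y)) (by fun_prop) fun y _ => hr)
  have hsupp : HasCompactSupport fun y => ν y • D q y := hν.hasCompactSupport.smul_right
  have hi : Integrable fun y => ν y • D q y :=
    (hν.contDiff.continuous.smul (hint q hq)).integrable_of_hasCompactSupport hsupp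
  refine ⟨?_, hi⟩
  refine (hasFDerivAt_integral_of_dominated_of_fderiv_le (𝕜 := ℝ)
    (s := Metric.closedBall q (q.2 / 2))
    (F := fun q y => (‖q.1 - y‖ ^ 2 + q.2 ^ 2) ^ (-s / 2) * ν y)
    (F' := fun q y => ν y • D q y) (bound := fun y => M * ‖ν y‖)
    (Metric.closedBall_mem_nhds q (by positivity)) ?_ ?_ hi.aestronglyMeasurable ?_ ?_ ?_)
  · filter_upwards [isOpen_upperHalf.mem_nhds hq] with r hr
    exact (integrable_mul_test (continuous_kernel_source s r.1 hr) hν).aestronglyMeasurable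
  · exact integrable_mul_test (continuous_kernel_source s q.1 hq') hν
  · refine Eventually.of_forall fun y r hr => ?_
    by_cases hy : y ∈ tsupport ν
    · rw [norm_smul, mul_comm]
      exact mul_le_mul_of_nonneg_right (hM (r, y) ⟨hr, hy⟩) (norm_nonneg _)
    · simp [image_eq_zero_of_notMem_tsupport hy]
  · exact (hν.contDiff.continuous.norm.integrable_of_hasCompactSupport
      hν.hasCompactSupport.norm).const_mul M
  · refine Eventually.of_forall fun y r hr => ?_
    exact (hasFDerivAt_kernel (hmem hr) y).mul_const (ν y)

lemma differentiableAt_Kext (s : ℝ) (hν : IsTestDensity ν) {q : EuclideanSpace ℝ (Fin d) × ℝ}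
    (hq : q ∈ upperHalf d) : DifferentiableAt ℝ (Kext d s ν) q :=
  (hasFDerivAt_Kext hν hq).1.differentiableAt

lemma continuousOn_Kext (s : ℝ) (hν : IsTestDensity ν) :
    ContinuousOn (Kext d s ν) (upperHalf d) := fun _ hq =>
  (differentiableAt_Kext s hν hq).continuousAt.continuousWithinAt

lemma fderiv_Kext_vertical (s : ℝ) (hν : IsTestDensity ν) {q : EuclideanSpace ℝ (Fin d) × ℝ}
    (hq : q ∈ upperHalf d) :
    fderiv ℝ (Kext d s ν) q (0, 1) = -s * q.2 * Kext d (s + 2) ν q := by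
  obtain ⟨h1, h2⟩ := hasFDerivAt_Kext (s := s) hν hq
  rw [h1.fderiv, ContinuousLinearMap.integral_apply h2, Kext, ← integral_const_mul]
  congr 1 with y
  simp
  ring

lemma Kext_partialDeriv_eq_integral (s : ℝ) (hν : IsTestDensity ν) {q : EuclideanSpace ℝ (Fin d) × ℝ}
    (hq : q ∈ upperHalf d) (i : Fin d) :
    Kext d s (partialDeriv i ν) q =
      -s * ∫ y, (q.1 i - y i) * (‖q.1 - y‖ ^ 2 + q.2 ^ 2) ^ (-(s + 2) / 2) * ν y := by
  have hd := fun y => hasFDerivAt_kernel_source (s := s) q.1 hq y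
  have hf : ∀ y, fderiv ℝ (fun y => (‖q.1 - y‖ ^ 2 + q.2 ^ 2) ^ (-s / 2)) y
      (EuclideanSpace.single i 1) =
      s * ((q.1 i - y i) * (‖q.1 - y‖ ^ 2 + q.2 ^ 2) ^ (-(s + 2) / 2)) := by
    intro y
    rw [(hd y).fderiv]
    simp [EuclideanSpace.inner_single_right]
    ring
  unfold Kext partialDeriv
  rw [integral_mul_fderiv_eq_neg_fderiv_mul_of_integrable]
  · simp_rw [hf]
    rw [neg_mul, ← integral_const_mul]
    congr 2 with y
    ring
  · simp_rw [hf]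
    refine integrable_mul_test (continuous_const.mul (Continuous.mul (by fun_prop)
      (continuous_kernel_source (s + 2) q.1 hq))) hν
  · exact integrable_mul_test (continuous_kernel_source s q.1 hq) (hν.partialDeriv i)
  · exact integrable_mul_test (continuous_kernel_source s q.1 hq) hν
  · exact fun y _ => (hd y).differentiableAt
  · exact fun y _ => hν.differentiable y

lemma fderiv_Kext_horizontal (s : ℝ) (hν : IsTestDensity ν) {q : EuclideanSpace ℝ (Fin d) × ℝ}
    (hq : q ∈ upperHalf d) (i : Fin d) :
    fderiv ℝ (Kext d s ν) q (EuclideanSpace.single i 1, 0) = Kext d s (partialDeriv i ν) q := by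
  obtain ⟨h1, h2⟩ := hasFDerivAt_Kext (s := s) hν hq
  rw [Kext_partialDeriv_eq_integral s hν hq, h1.fderiv,
    ContinuousLinearMap.integral_apply h2, ← integral_const_mul]
  congr 1 with y
  simp [EuclideanSpace.inner_single_right]
  ring

lemma sum_Kext_partialDeriv_partialDeriv (s : ℝ) (hν : IsTestDensity ν)
    {q : EuclideanSpace ℝ (Fin d) × ℝ} (hq : q ∈ upperHalf d) :
    ∑ i, Kext d s (partialDeriv i (partialDeriv i ν)) q =
      s * (s + 2 - d) * Kext d (s + 2) ν q - s * (s + 2) * q.2 ^ 2 * Kext d (s + 4) ν q := by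
  have hq' : 0 < q.2 := hq
  set k : EuclideanSpace ℝ (Fin d) → ℝ := fun y => (‖q.1 - y‖ ^ 2 + q.2 ^ 2) ^ (-(s + 2) / 2)
    with hk
  set k' : EuclideanSpace ℝ (Fin d) → ℝ := fun y => (‖q.1 - y‖ ^ 2 + q.2 ^ 2) ^ (-(s + 4) / 2)
    with hk'
  have hkc : Continuous k := continuous_kernel_source (s + 2) q.1 hq
  have hkc' : Continuous k' := continuous_kernel_source (s + 4) q.1 hq
  have hkk : ∀ y, k y = (‖q.1 - y‖ ^ 2 + q.2 ^ 2) * k' y := by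
    intro y
    simp only [hk, hk']
    rw [show -(s + 2) / 2 = -(s + 4) / 2 + 1 by ring, Real.rpow_add_one (sq_dist_pos hq' y).ne']
    ring
  have hd : ∀ (i : Fin d) y, HasFDerivAt (fun y => (q.1 i - y i) * k y)
      ((q.1 i - y i) • (((s + 2) * k' y) • innerSL ℝ (q.1 - y)) +
        k y • -(EuclideanSpace.proj i : EuclideanSpace ℝ (Fin d) →L[ℝ] ℝ)) y := by
    intro i y
    have h1 := hasFDerivAt_kernel_source (s := s + 2) q.1 hq y
    rw [show s + 2 + 2 = s + 4 by ring] at h1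
    exact (((EuclideanSpace.proj (𝕜 := ℝ) i).hasFDerivAt (x := y)).const_sub (q.1 i)).mul h1
  have hf : ∀ i y, fderiv ℝ (fun y => (q.1 i - y i) * k y) y (EuclideanSpace.single i 1) =
      (s + 2) * (q.1 i - y i) ^ 2 * k' y - k y := by
    intro i y
    rw [(hd i y).fderiv]
    simp [EuclideanSpace.inner_single_right]
    ring
  have hi : ∀ i, Integrable fun y => ((s + 2) * (q.1 i - y i) ^ 2 * k' y - k y) * ν y := fun i =>
    integrable_mul_test (by fun_prop) hν
  have h1 : ∀ i, Kext d s (partialDeriv i (partialDeriv i ν)) q =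
      s * ∫ y, ((s + 2) * (q.1 i - y i) ^ 2 * k' y - k y) * ν y := by
    intro i
    rw [Kext_partialDeriv_eq_integral s (hν.partialDeriv i) hq]
    change -s * ∫ y, (q.1 i - y i) * k y * fderiv ℝ ν y (EuclideanSpace.single i 1) = _
    rw [integral_mul_fderiv_eq_neg_fderiv_mul_of_integrable]
    · simp_rw [hf]
      ring
    · simp_rw [hf]
      exact hi i
    · exact integrable_mul_test (f := fun y => (q.1 i - y i) * k y) (by fun_prop) (hν.partialDeriv i)
    · exact integrable_mul_test (f := fun y => (q.1 i - y i) * k y) (by fun_prop) hν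
    · exact fun y _ => (hd i y).differentiableAt
    · exact fun y _ => hν.differentiable y
  simp_rw [h1]
  rw [← Finset.mul_sum, ← integral_finsetSum _ fun i _ => hi i]
  have h2 : ∀ y, ∑ i, ((s + 2) * (q.1 i - y i) ^ 2 * k' y - k y) * ν y =
      (s + 2 - d) * (k y * ν y) - (s + 2) * q.2 ^ 2 * (k' y * ν y) := by
    intro y
    rw [← Finset.sum_mul, Finset.sum_sub_distrib, ← Finset.sum_mul, ← Finset.mul_sum]
    have : ∑ i, (q.1 i - y i) ^ 2 = ‖q.1 - y‖ ^ 2 := by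
      rw [EuclideanSpace.norm_sq_eq]
      simp
    rw [this, Finset.sum_const, Finset.card_univ, Fintype.card_fin, nsmul_eq_mul]
    linear_combination (-(s + 2) * ν y) * hkk y
  simp_rw [h2]
  rw [integral_sub ((integrable_mul_test hkc hν).const_mul _)
    ((integrable_mul_test hkc' hν).const_mul _), integral_const_mul, integral_const_mul]
  unfold Kext
  ring

end PotentialCalculus

section PotentialBounds

variable {d : ℕ} {s : ℝ} {ν : EuclideanSpace ℝ (Fin d) → ℝ}

lemma IsTestDensity.exists_bound (hν : IsTestDensity ν) : ∃ C, ∀ y, |ν y| ≤ C :=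
  hν.hasCompactSupport.exists_bound_of_continuous hν.contDiff.continuous

lemma exists_integral_kernel_le (hs : 0 < s) (hsd : s < d) (hν : IsTestDensity ν) :
    ∃ M, ∀ q ∈ upperHalf d, ∫ y, (‖q.1 - y‖ ^ 2 + q.2 ^ 2) ^ (-s / 2) * |ν y| ≤ M := by
  obtain ⟨C, hC⟩ := hν.exists_bound
  have hC0 : 0 ≤ C := (abs_nonneg _).trans (hC 0)
  have hd : 1 ≤ d := by
    rcases Nat.eq_zero_or_pos d with h | h
    · subst h; norm_num at hsd; linarith
    · exact h
  have hne : Nonempty (Fin d) := ⟨⟨0, hd⟩⟩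
  have hball : IntegrableOn (fun z : EuclideanSpace ℝ (Fin d) => ‖z‖ ^ (-s)) (Metric.ball 0 1) := by
    refine integrableOn_ball_of_norm_le_rpow (C := 1) (α := s) (by simpa using hd) (by simpa using hsd)
      (Eventually.of_forall fun z => ?_) ?_
    · rw [Real.norm_of_nonneg (by positivity), one_mul]
    · exact (measurable_norm.pow_const _).aestronglyMeasurable
  set g : EuclideanSpace ℝ (Fin d) → ℝ := (Metric.ball 0 1).indicator fun z => ‖z‖ ^ (-s) with hg
  have hgi : Integrable g := hball.integrable_indicator Metric.isOpen_ball.measurableSet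
  have hνi : Integrable fun y => |ν y| :=
    (hν.contDiff.continuous.integrable_of_hasCompactSupport hν.hasCompactSupport).abs
  refine ⟨C * (∫ z, g z) + ∫ y, |ν y|, fun q hq => ?_⟩
  have hgi' : Integrable fun y => C * g (q.1 - y) := (hgi.comp_sub_left q.1).const_mul C
  have hint : ∫ y, (C * g (q.1 - y) + |ν y|) = C * (∫ z, g z) + ∫ y, |ν y| := by
    rw [integral_add hgi' hνi, integral_const_mul, integral_sub_left_eq_self g volume q.1]
  rw [← hint]
  refine integral_mono_ae ?_ (hgi'.add hνi) ?_
  · exact ((continuous_kernel_source s q.1 hq).mul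
      hν.contDiff.continuous.abs).integrable_of_hasCompactSupport
      (hν.hasCompactSupport.norm.mul_left)
  · filter_upwards [compl_mem_ae_iff.2 (measure_singleton (μ := volume) q.1)] with y hy
    have hpos : 0 < ‖q.1 - y‖ := norm_pos_iff.2 (sub_ne_zero.2 (Ne.symm hy))
    have h1 : (‖q.1 - y‖ ^ 2 + q.2 ^ 2) ^ (-s / 2) ≤ ‖q.1 - y‖ ^ (-s) := by
      have : ‖q.1 - y‖ ^ (-s) = (‖q.1 - y‖ ^ 2) ^ (-s / 2) := by
        rw [← Real.rpow_natCast, ← Real.rpow_mul hpos.le]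
        congr 1
        push_cast
        ring
      rw [this]
      exact Real.rpow_le_rpow_of_nonpos (by positivity) (by nlinarith) (by linarith)
    have hν0 := abs_nonneg (ν y)
    by_cases hb : ‖q.1 - y‖ < 1
    · have : g (q.1 - y) = ‖q.1 - y‖ ^ (-s) := indicator_of_mem (by simpa using hb) _
      simp only [this]
      have := mul_le_mul h1 (hC y) hν0 (by positivity)
      nlinarith
    · have : g (q.1 - y) = 0 := indicator_of_notMem (by simpa using hb) _
      simp only [this, mul_zero, zero_add]
      have h2 : ‖q.1 - y‖ ^ (-s) ≤ 1 :=
        Real.rpow_le_one_of_one_le_of_nonpos (not_lt.1 hb) (by linarith)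
      nlinarith

lemma pow_mul_abs_Kext_le (s : ℝ) (k : ℕ) (hν : IsTestDensity ν)
    {q : EuclideanSpace ℝ (Fin d) × ℝ} (hq : q ∈ upperHalf d) :
    q.2 ^ (2 * k) * |Kext d (s + 2 * k) ν q| ≤
      ∫ y, (‖q.1 - y‖ ^ 2 + q.2 ^ 2) ^ (-s / 2) * |ν y| := by
  have hq' : 0 < q.2 := hq
  have h1 : |Kext d (s + 2 * k) ν q| ≤
      ∫ y, (‖q.1 - y‖ ^ 2 + q.2 ^ 2) ^ (-(s + 2 * k) / 2) * |ν y| := by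
    refine (abs_integral_le_integral_abs).trans_eq ?_
    congr 1 with y
    rw [abs_mul, abs_of_nonneg (Real.rpow_nonneg (sq_dist_pos hq' y).le _)]
  refine (mul_le_mul_of_nonneg_left h1 (by positivity)).trans ?_
  rw [← integral_const_mul]
  have hsupp : HasCompactSupport fun y => |ν y| := hν.hasCompactSupport.norm
  have hc := hν.contDiff.continuous.abs
  refine integral_mono ?_ ?_ fun y => ?_
  · exact (((continuous_kernel_source _ q.1 hq).mul hc).integrable_of_hasCompactSupport
      hsupp.mul_left).const_mul _
  · exact ((continuous_kernel_source _ q.1 hq).mul hc).integrable_of_hasCompactSupport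
      hsupp.mul_left
  · have hB := sq_dist_pos hq' y
    simp only
    rw [← mul_assoc]
    refine mul_le_mul_of_nonneg_right ?_ (abs_nonneg _)
    rw [show -(s + 2 * k) / 2 = -s / 2 - k by ring, Real.rpow_sub hB, Real.rpow_natCast,
      mul_div_assoc', div_le_iff₀ (by positivity), mul_comm, pow_mul]
    exact mul_le_mul_of_nonneg_left
      (pow_le_pow_left₀ (sq_nonneg _) (le_add_of_nonneg_left (sq_nonneg _)) k)
      (Real.rpow_nonneg hB.le _)

lemma exists_bound_Kext (hs : 0 < s) (hsd : s < d) (hν : IsTestDensity ν) :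
    ∃ M, ∀ q ∈ upperHalf d, |Kext d s ν q| ≤ M ∧ q.2 ^ 2 * |Kext d (s + 2) ν q| ≤ M ∧
      q.2 ^ 4 * |Kext d (s + 4) ν q| ≤ M := by
  obtain ⟨M, hM⟩ := exists_integral_kernel_le hs hsd hν
  refine ⟨M, fun q hq => ⟨?_, ?_, ?_⟩⟩
  · have := pow_mul_abs_Kext_le s 0 hν hq
    simp only [mul_zero, pow_zero, one_mul, CharP.cast_eq_zero, add_zero] at this
    exact this.trans (hM q hq)
  · have := pow_mul_abs_Kext_le s 1 hν hq
    norm_num at this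
    exact this.trans (hM q hq)
  · have := pow_mul_abs_Kext_le s 2 hν hq
    norm_num at this
    exact this.trans (hM q hq)

/-- Decay at infinity in the upper half-space. -/
def DecaysOnUpperHalf (F : EuclideanSpace ℝ (Fin d) × ℝ → ℝ) : Prop :=
  ∀ ε > 0, ∃ R > 0, ∀ q ∈ upperHalf d, R ≤ ‖q‖ → |F q| < ε

lemma decaysOnUpperHalf_Kext (hs : 0 < s) (hν : IsTestDensity ν) :
    DecaysOnUpperHalf (Kext d s ν) := by
  intro ε hε
  obtain ⟨ρ, hρ⟩ := hν.hasCompactSupport.isCompact.isBounded.subset_closedBall 0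
  have hνi : Integrable fun y => |ν y| :=
    (hν.contDiff.continuous.integrable_of_hasCompactSupport hν.hasCompactSupport).abs
  have hlim : Tendsto (fun R : ℝ => (R / 2) ^ (-s) * ∫ y, |ν y|) atTop (𝓝 0) := by
    have := ((tendsto_rpow_neg_atTop hs).comp
      (tendsto_id.atTop_div_const (zero_lt_two' ℝ))).mul_const (∫ y, |ν y|)
    simpa using this
  obtain ⟨R, hRε, hR1, hRρ⟩ := ((hlim.eventually (gt_mem_nhds hε)).and
    ((eventually_ge_atTop 1).and (eventually_ge_atTop (2 * ρ)))).exists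
  refine ⟨R, by linarith, fun q hq hqR => lt_of_le_of_lt ?_ hRε⟩
  have hq' : 0 < q.2 := hq
  have h0 := pow_mul_abs_Kext_le s 0 hν hq
  simp only [mul_zero, pow_zero, one_mul, CharP.cast_eq_zero, add_zero] at h0
  refine h0.trans ?_
  rw [← integral_const_mul]
  refine integral_mono ?_ (hνi.const_mul _) fun y => ?_
  · exact ((continuous_kernel_source s q.1 hq).mul
      hν.contDiff.continuous.abs).integrable_of_hasCompactSupport
      (hν.hasCompactSupport.norm.mul_left)
  · by_cases hy : y ∈ tsupport ν
    · refine mul_le_mul_of_nonneg_right ?_ (abs_nonneg _)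
      have hyρ : ‖y‖ ≤ ρ := by simpa using hρ hy
      have h1 : (R / 2) ^ 2 ≤ ‖q.1 - y‖ ^ 2 + q.2 ^ 2 := by
        rcases le_max_iff.1 (Prod.norm_def (x := q) ▸ hqR) with h | h
        · have : R / 2 ≤ ‖q.1 - y‖ := by
            have := norm_sub_norm_le q.1 y
            linarith
          nlinarith [sq_nonneg q.2]
        · rw [Real.norm_of_nonneg hq'.le] at h
          nlinarith [sq_nonneg ‖q.1 - y‖]
      have h2 : (R / 2) ^ (-s) = ((R / 2) ^ 2) ^ (-s / 2) := by
        rw [← Real.rpow_natCast, ← Real.rpow_mul (by linarith)]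
        congr 1
        push_cast
        ring
      rw [h2]
      exact Real.rpow_le_rpow_of_nonpos (by positivity) h1 (by linarith)
    · simp [image_eq_zero_of_notMem_tsupport hy]

end PotentialBounds

section Truncation

/-- A continuous cutoff that vanishes for `n * |t| ≤ 1` and tends to `1` off the origin. -/
def cutoff (n : ℕ) (t : ℝ) : ℝ := min 1 (max 0 (n * |t| - 1))

/-- The primitive of `cutoff n`, a `C¹` truncation of the identity. -/
def truncId (n : ℕ) (t : ℝ) : ℝ := ∫ u in (0 : ℝ)..t, cutoff n u

/-- The primitive of `truncId n`, a `C²` truncation of `t ^ 2 / 2`. -/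
def truncSq (n : ℕ) (t : ℝ) : ℝ := ∫ u in (0 : ℝ)..t, truncId n u

variable {n : ℕ} {t : ℝ}

lemma continuous_cutoff (n : ℕ) : Continuous (cutoff n) := by
  unfold cutoff
  fun_prop

lemma cutoff_nonneg : 0 ≤ cutoff n t := le_min zero_le_one (le_max_left _ _)

lemma cutoff_le_one : cutoff n t ≤ 1 := min_le_left _ _

lemma cutoff_eq_zero (h : n * |t| ≤ 1) : cutoff n t = 0 := by
  unfold cutoff
  rw [max_eq_left (by linarith)]
  simp

lemma hasDerivAt_truncId : HasDerivAt (truncId n) (cutoff n t) t :=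
  intervalIntegral.integral_hasDerivAt_right ((continuous_cutoff n).intervalIntegrable _ _)
    (continuous_cutoff n).stronglyMeasurable.stronglyMeasurableAtFilter
    (continuous_cutoff n).continuousAt

lemma continuous_truncId (n : ℕ) : Continuous (truncId n) :=
  continuous_iff_continuousAt.2 fun _ => hasDerivAt_truncId.continuousAt

lemma hasDerivAt_truncSq : HasDerivAt (truncSq n) (truncId n t) t :=
  intervalIntegral.integral_hasDerivAt_right ((continuous_truncId n).intervalIntegrable _ _)
    (continuous_truncId n).stronglyMeasurable.stronglyMeasurableAtFilter
    (continuous_truncId n).continuousAt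

lemma continuous_truncSq (n : ℕ) : Continuous (truncSq n) :=
  continuous_iff_continuousAt.2 fun _ => hasDerivAt_truncSq.continuousAt

lemma mul_abs_le_of_mem_uIcc {u : ℝ} (h : n * |t| ≤ 1) (hu : u ∈ uIcc 0 t) : n * |u| ≤ 1 := by
  have : |u| ≤ |t| := by simpa using abs_sub_left_of_mem_uIcc hu
  exact (mul_le_mul_of_nonneg_left this (Nat.cast_nonneg n)).trans h

lemma truncId_eq_zero (h : n * |t| ≤ 1) : truncId n t = 0 := by
  unfold truncId
  rw [intervalIntegral.integral_congr (g := fun _ => 0) fun u hu =>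
    cutoff_eq_zero (mul_abs_le_of_mem_uIcc h hu)]
  simp

lemma truncSq_eq_zero (h : n * |t| ≤ 1) : truncSq n t = 0 := by
  unfold truncSq
  rw [intervalIntegral.integral_congr (g := fun _ => 0) fun u hu =>
    truncId_eq_zero (mul_abs_le_of_mem_uIcc h hu)]
  simp

lemma truncId_neg : truncId n (-t) = -truncId n t := by
  have h := intervalIntegral.integral_comp_neg (a := 0) (b := t) (cutoff n)
  have h' : ∀ u, cutoff n (-u) = cutoff n u := fun u => by simp [cutoff]
  simp only [h', neg_zero] at h
  unfold truncId
  rw [h, intervalIntegral.integral_symm]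

lemma truncSq_neg : truncSq n (-t) = truncSq n t := by
  have h := intervalIntegral.integral_comp_neg (a := 0) (b := t) (truncId n)
  simp only [truncId_neg, neg_zero, intervalIntegral.integral_neg] at h
  unfold truncSq
  rw [intervalIntegral.integral_symm, ← h, neg_neg]

lemma truncId_nonneg (ht : 0 ≤ t) : 0 ≤ truncId n t :=
  intervalIntegral.integral_nonneg ht fun _ _ => cutoff_nonneg

lemma truncId_le (ht : 0 ≤ t) : truncId n t ≤ t := by
  have h := intervalIntegral.integral_mono_on (μ := volume) ht
    ((continuous_cutoff n).intervalIntegrable _ _) intervalIntegrable_const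
    (fun u _ => cutoff_le_one (n := n) (t := u))
  simpa [truncId] using h

lemma sq_truncId_le_of_nonneg (ht : 0 ≤ t) : truncId n t ^ 2 ≤ 2 * truncSq n t := by
  have h := monotoneOn_of_deriv_nonneg (convex_Ici (0 : ℝ))
    (f := fun u => 2 * truncSq n u - truncId n u ^ 2)
    (((continuous_truncSq n).const_mul 2).sub ((continuous_truncId n).pow 2)).continuousOn
    (fun u _ => ((hasDerivAt_truncSq.const_mul 2).sub
      (hasDerivAt_truncId.pow 2)).differentiableAt.differentiableWithinAt)
    (fun u hu => by
      rw [interior_Ici, mem_Ioi] at hu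
      have := ((hasDerivAt_truncSq (n := n) (t := u)).const_mul 2).sub
        ((hasDerivAt_truncId (n := n) (t := u)).pow 2)
      refine le_of_le_of_eq ?_ this.deriv.symm
      simp only [Nat.cast_ofNat, Nat.add_one_sub_one, pow_one]
      nlinarith [truncId_nonneg (n := n) hu.le, cutoff_le_one (n := n) (t := u)])
    (mem_Ici.2 le_rfl) ht ht
  have h0 : truncSq n 0 = 0 ∧ truncId n 0 = 0 := ⟨by simp [truncSq], by simp [truncId]⟩
  simp only [h0.1, h0.2] at h
  linarith

lemma sq_truncId_le : truncId n t ^ 2 ≤ 2 * truncSq n t := by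
  rcases le_total 0 t with h | h
  · exact sq_truncId_le_of_nonneg h
  · have := sq_truncId_le_of_nonneg (n := n) (neg_nonneg.2 h)
    rwa [truncId_neg, truncSq_neg, neg_sq] at this

lemma truncSq_nonneg : 0 ≤ truncSq n t := by
  nlinarith [sq_truncId_le (n := n) (t := t), sq_nonneg (truncId n t)]

lemma truncSq_le : truncSq n t ≤ t ^ 2 / 2 := by
  have key : ∀ u : ℝ, 0 ≤ u → truncSq n u ≤ u ^ 2 / 2 := by
    intro u hu
    have h := intervalIntegral.integral_mono_on (μ := volume) hu
      ((continuous_truncId n).intervalIntegrable _ _) (continuous_id.intervalIntegrable 0 u)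
      (fun v hv => truncId_le (n := n) hv.1)
    simpa [truncSq] using h
  rcases le_total 0 t with h | h
  · exact key t h
  · have := key (-t) (neg_nonneg.2 h)
    rwa [truncSq_neg, neg_sq] at this

lemma abs_truncId_le : |truncId n t| ≤ |t| := by
  rcases le_total 0 t with h | h
  · rw [abs_of_nonneg h, abs_of_nonneg (truncId_nonneg h)]
    exact truncId_le h
  · rw [← abs_neg, ← truncId_neg, ← abs_neg t, abs_of_nonneg (neg_nonneg.2 h),
      abs_of_nonneg (truncId_nonneg (neg_nonneg.2 h))]
    exact truncId_le (neg_nonneg.2 h)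

lemma truncId_mul_self_nonneg : 0 ≤ truncId n t * t := by
  rcases le_total 0 t with h | h
  · exact mul_nonneg (truncId_nonneg h) h
  · have := mul_nonneg (truncId_nonneg (n := n) (neg_nonneg.2 h)) (neg_nonneg.2 h)
    rwa [truncId_neg, neg_mul_neg] at this

lemma tendsto_cutoff (ht : t ≠ 0) : Tendsto (fun n => cutoff n t) atTop (𝓝 1) := by
  have h : Tendsto (fun n : ℕ => (n : ℝ) * |t|) atTop atTop :=
    tendsto_natCast_atTop_atTop.atTop_mul_const (abs_pos.2 ht)
  refine tendsto_const_nhds.congr' ?_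
  filter_upwards [h.eventually_ge_atTop 2] with n hn
  unfold cutoff
  rw [min_eq_left (le_max_of_le_right (by linarith))]

lemma tendsto_truncId (t : ℝ) : Tendsto (fun n => truncId n t) atTop (𝓝 t) := by
  have h : Tendsto (fun n => truncId n t) atTop (𝓝 (∫ _ in (0 : ℝ)..t, (1 : ℝ))) := by
    refine intervalIntegral.tendsto_integral_filter_of_dominated_convergence (fun _ => 1)
      (Eventually.of_forall fun n => (continuous_cutoff n).aestronglyMeasurable)
      (Eventually.of_forall fun n => Eventually.of_forall fun u _ => ?_)
      intervalIntegrable_const ?_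
    · rw [Real.norm_of_nonneg cutoff_nonneg]
      exact cutoff_le_one
    · filter_upwards [compl_mem_ae_iff.2 (measure_singleton (μ := volume) (0 : ℝ))] with u hu _
      exact tendsto_cutoff hu
  simpa using h

lemma tendsto_truncSq (t : ℝ) : Tendsto (fun n => truncSq n t) atTop (𝓝 (t ^ 2 / 2)) := by
  have h : Tendsto (fun n => truncSq n t) atTop (𝓝 (∫ u in (0 : ℝ)..t, u)) :=
    intervalIntegral.tendsto_integral_filter_of_dominated_convergence (fun u => |u|)
      (Eventually.of_forall fun n => (continuous_truncId n).aestronglyMeasurable)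
      (Eventually.of_forall fun n => Eventually.of_forall fun u _ => abs_truncId_le)
      (continuous_abs.intervalIntegrable _ _) (Eventually.of_forall fun u _ => tendsto_truncId u)
  simpa using h

end Truncation

section HalfSpaceIntegrals

variable {d : ℕ}

lemma volume_restrict_upperHalf : (volume : Measure (EuclideanSpace ℝ (Fin d) × ℝ)).restrict
    (upperHalf d) = (volume : Measure (EuclideanSpace ℝ (Fin d))).prod
      ((volume : Measure ℝ).restrict (Ioi 0)) := by
  have h : upperHalf d = univ ×ˢ Ioi (0 : ℝ) := by
    ext q
    simp
  rw [h, Measure.volume_eq_prod, ← Measure.prod_restrict, Measure.restrict_univ]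

lemma measurableSet_upperHalf : MeasurableSet (upperHalf d) := isOpen_upperHalf.measurableSet

lemma integrableOn_upperHalf_of_bound {T : EuclideanSpace ℝ (Fin d) × ℝ → ℝ} {C R σ : ℝ}
    (hT : ContinuousOn T (upperHalf d)) (hσ : -1 < σ)
    (hb : ∀ q ∈ upperHalf d, |T q| ≤ C * q.2 ^ σ)
    (hz : ∀ q ∈ upperHalf d, R ≤ ‖q‖ → T q = 0) : IntegrableOn T (upperHalf d) := by
  have h1 : Integrable ((Metric.closedBall (0 : EuclideanSpace ℝ (Fin d)) R).indicator
      fun _ => (1 : ℝ)) :=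
    (integrable_indicator_iff Metric.isClosed_closedBall.measurableSet).2
      (integrableOn_const (hs := (isCompact_closedBall _ _).measure_lt_top.ne))
  have h2 : Integrable ((Ioo 0 R).indicator fun t : ℝ => C * t ^ σ)
      (volume.restrict (Ioi 0)) := by
    have : IntegrableOn (fun t : ℝ => C * t ^ σ) (Ioo 0 R) := by
      by_cases hR : 0 < R
      · exact ((intervalIntegral.integrableOn_Ioo_rpow_iff hR).2 hσ).const_mul C
      · simp [Ioo_eq_empty hR]
    exact (this.integrable_indicator measurableSet_Ioo).mono_measure Measure.restrict_le_self
  have h3 := h1.mul_prod h2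
  rw [← volume_restrict_upperHalf] at h3
  refine Integrable.mono' h3 (hT.aestronglyMeasurable measurableSet_upperHalf) ?_
  refine (ae_restrict_iff' measurableSet_upperHalf).2 (Eventually.of_forall fun q hq => ?_)
  have hq' : 0 < q.2 := hq
  by_cases hR : R ≤ ‖q‖
  · rw [hz q hq hR, norm_zero]
    refine mul_nonneg (indicator_nonneg (fun _ _ => zero_le_one) _) ?_
    by_cases ht : q.2 ∈ Ioo 0 R
    · rw [indicator_of_mem ht]
      exact (abs_nonneg _).trans (hb q hq)
    · rw [indicator_of_notMem ht]
  · have h4 := max_lt_iff.1 (Prod.norm_def (x := q) ▸ not_le.1 hR)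
    have h5 : q.2 < R := lt_of_abs_lt h4.2
    rw [indicator_of_mem (by simpa using h4.1.le), indicator_of_mem (mem_Ioo.2 ⟨hq', h5⟩), one_mul]
    exact hb q hq

lemma integral_vertical_deriv_eq_zero {G G' : EuclideanSpace ℝ (Fin d) × ℝ → ℝ} {C R κ : ℝ}
    (hκ : 0 < κ) (h0 : ∀ x, G (x, 0) = 0)
    (hd : ∀ q ∈ upperHalf d, HasDerivAt (fun t => G (q.1, t)) (G' q) q.2)
    (hb : ∀ q ∈ upperHalf d, |G q| ≤ C * q.2 ^ κ)
    (hz : ∀ q ∈ upperHalf d, R ≤ ‖q‖ → G q = 0) (hi : IntegrableOn G' (upperHalf d)) :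
    ∫ q in upperHalf d, G' q = 0 := by
  unfold IntegrableOn at hi
  rw [volume_restrict_upperHalf] at hi ⊢
  rw [integral_prod _ hi]
  refine integral_eq_zero_of_ae ?_
  filter_upwards [hi.prod_right_ae] with x hx
  have h := integral_Ioi_of_hasDerivAt_of_tendsto (f := fun t => G (x, t)) (a := 0) (m := 0) ?_
    (fun t ht => hd (x, t) ht) hx ?_
  · simpa [h0] using h
  · have h1 : Tendsto (fun t : ℝ => C * t ^ κ) (𝓝[Ioi 0] 0) (𝓝 0) := by
      have : ContinuousAt (fun t : ℝ => C * t ^ κ) 0 :=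
        continuousAt_const.mul (Real.continuousAt_rpow_const 0 κ (Or.inr hκ.le))
      have h2 := this.tendsto
      simp only [Real.zero_rpow hκ.ne', mul_zero] at h2
      exact h2.mono_left nhdsWithin_le_nhds
    rw [← Ioi_union_left, continuousWithinAt_union]
    refine ⟨?_, continuousWithinAt_singleton⟩
    change Tendsto _ _ (𝓝 (G (x, 0)))
    rw [h0]
    exact squeeze_zero_norm' (eventually_nhdsWithin_of_forall fun t ht => hb (x, t) ht) h1
  · refine tendsto_const_nhds.congr' ?_
    filter_upwards [eventually_ge_atTop R, eventually_gt_atTop 0] with t ht ht0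
    refine (hz (x, t) ht0 (ht.trans ?_)).symm
    exact (le_abs_self t).trans (le_max_right _ _)

lemma integral_horizontal_by_parts {f f' g g' : EuclideanSpace ℝ (Fin d) × ℝ → ℝ}
    {v : EuclideanSpace ℝ (Fin d)}
    (hf : ∀ q ∈ upperHalf d, HasLineDerivAt ℝ (fun x => f (x, q.2)) (f' q) q.1 v)
    (hg : ∀ q ∈ upperHalf d, HasLineDerivAt ℝ (fun x => g (x, q.2)) (g' q) q.1 v) {w : ℝ → ℝ}
    (hw : ∀ t > 0, w t ≠ 0)
    (h1 : IntegrableOn (fun q => w q.2 * (f' q * g q)) (upperHalf d))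
    (h2 : IntegrableOn (fun q => w q.2 * (f q * g' q)) (upperHalf d))
    (h3 : IntegrableOn (fun q => w q.2 * (f q * g q)) (upperHalf d)) :
    ∫ q in upperHalf d, w q.2 * (f q * g' q) = -∫ q in upperHalf d, w q.2 * (f' q * g q) := by
  unfold IntegrableOn at h1 h2 h3
  rw [volume_restrict_upperHalf] at h1 h2 h3 ⊢
  rw [integral_prod_symm _ h1, integral_prod_symm _ h2, ← integral_neg]
  refine integral_congr_ae ?_
  filter_upwards [h1.prod_left_ae, h2.prod_left_ae, h3.prod_left_ae,
    ae_restrict_mem measurableSet_Ioi] with t ht1 ht2 ht3 ht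
  have hu : ∀ {k : EuclideanSpace ℝ (Fin d) → ℝ}, Integrable (fun x => w t * k x) → Integrable k :=
    fun hk => by simpa [← mul_assoc, inv_mul_cancel₀ (hw t ht)] using hk.const_mul (w t)⁻¹
  rw [integral_const_mul, integral_const_mul]
  have := integral_bilinear_hasLineDerivAt_right_eq_neg_left_of_integrable
    (B := ContinuousLinearMap.mul ℝ ℝ) (μ := volume) (v := v)
    (f := fun x => f (x, t)) (f' := fun x => f' (x, t)) (g := fun x => g (x, t))
    (g' := fun x => g' (x, t)) (hu ht1) (hu ht2) (hu ht3)
    (fun x _ => hf (x, t) ht) (fun x _ => hg (x, t) ht)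
  simp only [ContinuousLinearMap.mul_apply'] at this
  rw [this, mul_neg]

end HalfSpaceIntegrals

section ZeroSets

lemma countable_setOf_simple_zero (f f' : ℝ → ℝ) :
    {t | f t = 0 ∧ HasDerivAt f (f' t) t ∧ f' t ≠ 0}.Countable := by
  refine (countable_setOfPred_isolated_right_within
    (s := {t | f t = 0 ∧ HasDerivAt f (f' t) t ∧ f' t ≠ 0})).mono fun t ht => ?_
  have h := (ht.2.1.eventually_ne (c := 0) ht.2.2).filter_mono (nhdsGT_le_nhdsNE t)
  refine And.intro ht ?_
  rw [inter_comm, nhdsWithin_inter', inf_principal_eq_bot]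
  filter_upwards [h] with z hz hz'
  exact hz hz'.1

/-- At almost every zero of a differentiable function its gradient vanishes. -/
lemma ae_fderiv_eq_zero_of_eq_zero {E : Type*} [NormedAddCommGroup E] [NormedSpace ℝ E]
    [FiniteDimensional ℝ E] [MeasurableSpace E] [BorelSpace E] (ρ : Measure E)
    [ρ.IsAddHaarMeasure] {U : Set E} (hU : IsOpen U) {F : E → ℝ} (hF : DifferentiableOn ℝ F U)
    (v : E) : ∀ᵐ q ∂ρ, q ∈ U → F q = 0 → fderiv ℝ F q v = 0 := by
  have hs : MeasurableSet {q | q ∈ U → F q = 0 → fderiv ℝ F q v = 0} := by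
    have h1 : MeasurableSet (U ∩ F ⁻¹' {0}ᶜ) :=
      (hF.continuousOn.isOpen_inter_preimage hU isOpen_compl_singleton).measurableSet
    have h2 : MeasurableSet {q | fderiv ℝ F q v = 0} :=
      measurableSet_eq_fun (measurable_fderiv_apply_const ℝ F v) measurable_const
    have h3 : {q | q ∈ U → F q = 0 → fderiv ℝ F q v = 0} =
        Uᶜ ∪ (U ∩ F ⁻¹' {0}ᶜ) ∪ {q | fderiv ℝ F q v = 0} := by
      ext q
      simp only [mem_ofPred_eq, mem_union, mem_compl_iff, mem_inter_iff, mem_preimage,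
        mem_singleton_iff]
      tauto
    rw [h3]
    exact (hU.measurableSet.compl.union h1).union h2
  refine ae_mem_of_ae_add_linearMap_mem (LinearMap.toSpanSingleton ℝ E v) volume ρ hs fun y => ?_
  have hc := countable_setOf_simple_zero (fun t : ℝ => F (y + t • v))
    (fun t : ℝ => fderiv ℝ F (y + t • v) v)
  filter_upwards [hc.ae_notMem volume] with t ht hU' h0
  by_contra hne
  refine ht ⟨h0, ?_, hne⟩
  have h1 := (hF.differentiableAt (hU.mem_nhds hU')).hasFDerivAt
  have h2 : HasDerivAt (fun t : ℝ => y + t • v) v t := by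
    simpa using ((hasDerivAt_id t).smul_const v).const_add y
  exact h1.comp_hasDerivAt t h2

end ZeroSets

section PotentialSlices

variable {d : ℕ} {s : ℝ} {ν : EuclideanSpace ℝ (Fin d) → ℝ}

lemma hasDerivAt_Kext_vertical (s : ℝ) (hν : IsTestDensity ν) {q : EuclideanSpace ℝ (Fin d) × ℝ}
    (hq : q ∈ upperHalf d) :
    HasDerivAt (fun t => Kext d s ν (q.1, t)) (-s * q.2 * Kext d (s + 2) ν q) q.2 := by
  rw [← fderiv_Kext_vertical s hν hq]
  exact HasFDerivAt.comp_hasDerivAt q.2 (differentiableAt_Kext s hν hq).hasFDerivAt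
    ((hasDerivAt_const q.2 q.1).prodMk (hasDerivAt_id q.2))

lemma hasLineDerivAt_Kext (s : ℝ) (hν : IsTestDensity ν) {q : EuclideanSpace ℝ (Fin d) × ℝ}
    (hq : q ∈ upperHalf d) (i : Fin d) :
    HasLineDerivAt ℝ (fun x => Kext d s ν (x, q.2)) (Kext d s (partialDeriv i ν) q) q.1
      (EuclideanSpace.single i 1) := by
  rw [← fderiv_Kext_horizontal s hν hq]
  have h1 : HasFDerivAt (fun x => (x, q.2))
      (ContinuousLinearMap.inl ℝ (EuclideanSpace ℝ (Fin d)) ℝ) q.1 := hasFDerivAt_prodMk_left _ _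
  have h2 := (HasFDerivAt.comp q.1 (differentiableAt_Kext s hν hq).hasFDerivAt h1).hasLineDerivAt
    (EuclideanSpace.single i 1)
  rw [ContinuousLinearMap.comp_apply, ContinuousLinearMap.inl_apply] at h2
  exact h2

lemma ae_Kext_eq_zero (s : ℝ) (hν : IsTestDensity ν) :
    ∀ᵐ q ∂(volume.restrict (upperHalf d)), Kext d s ν q = 0 →
      s * q.2 * Kext d (s + 2) ν q = 0 ∧ ∀ i, Kext d s (partialDeriv i ν) q = 0 := by
  have hd : DifferentiableOn ℝ (Kext d s ν) (upperHalf d) := fun q hq =>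
    (differentiableAt_Kext s hν hq).differentiableWithinAt
  have : (volume : Measure (EuclideanSpace ℝ (Fin d) × ℝ)).IsAddHaarMeasure := by
    rw [Measure.volume_eq_prod]
    infer_instance
  have h1 := ae_fderiv_eq_zero_of_eq_zero volume isOpen_upperHalf hd (0, 1)
  have h2 := ae_all_iff.2 fun i : Fin d => ae_fderiv_eq_zero_of_eq_zero volume isOpen_upperHalf hd
    (EuclideanSpace.single i 1, 0)
  filter_upwards [ae_restrict_of_ae h1, ae_restrict_of_ae h2,
    ae_restrict_mem measurableSet_upperHalf] with q h1 h2 hq h0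
  refine ⟨?_, fun i => ?_⟩
  · have := h1 hq h0
    rw [fderiv_Kext_vertical s hν hq] at this
    linarith
  · rw [← fderiv_Kext_horizontal s hν hq i]
    exact h2 i hq h0

end PotentialSlices

section TruncatedIdentities

variable {d : ℕ} {s σ : ℝ} {ν ν' : EuclideanSpace ℝ (Fin d) → ℝ}

lemma continuousOn_rpow_snd (σ : ℝ) :
    ContinuousOn (fun q : EuclideanSpace ℝ (Fin d) × ℝ => q.2 ^ σ) (upperHalf d) :=
  continuousOn_snd.rpow_const fun _ hq => Or.inl (ne_of_gt hq)

lemma integrableOn_rpow_mul {g : EuclideanSpace ℝ (Fin d) × ℝ → ℝ} {C R : ℝ} (hσ : -1 < σ)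
    (hg : ContinuousOn g (upperHalf d)) (hb : ∀ q ∈ upperHalf d, |g q| ≤ C)
    (hz : ∀ q ∈ upperHalf d, R ≤ ‖q‖ → g q = 0) :
    IntegrableOn (fun q => q.2 ^ σ * g q) (upperHalf d) := by
  refine integrableOn_upperHalf_of_bound (C := C) (R := R) ((continuousOn_rpow_snd σ).mul hg) hσ
    (fun q hq => ?_) fun q hq hR => by rw [hz q hq hR, mul_zero]
  rw [abs_mul, abs_of_nonneg (Real.rpow_nonneg (le_of_lt hq) _), mul_comm]
  exact mul_le_mul_of_nonneg_right (hb q hq) (Real.rpow_nonneg (le_of_lt hq) _)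

lemma exists_radius_Kext (hs : 0 < s) (hν : IsTestDensity ν) (n : ℕ) :
    ∃ R > 0, ∀ q ∈ upperHalf d, R ≤ ‖q‖ → n * |Kext d s ν q| ≤ 1 := by
  obtain ⟨R, hR, h⟩ := decaysOnUpperHalf_Kext hs hν (1 / (n + 1)) (by positivity)
  refine ⟨R, hR, fun q hq hqR => ?_⟩
  have h1 := h q hq hqR
  rw [lt_div_iff₀ (by positivity)] at h1
  linarith [abs_nonneg (Kext d s ν q)]

lemma continuousOn_comp_Kext {φ : ℝ → ℝ} (hφ : Continuous φ) (s : ℝ) (hν : IsTestDensity ν) :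
    ContinuousOn (fun q => φ (Kext d s ν q)) (upperHalf d) :=
  hφ.comp_continuousOn (continuousOn_Kext s hν)

/-- Integrability of `ξ ^ σ * φ(K) * g` for `φ` vanishing near the origin. -/
lemma integrableOn_rpow_mul_comp_Kext (hσ : -1 < σ) (hs : 0 < s) (hsd : s < d)
    (hν : IsTestDensity ν) {n : ℕ} {φ : ℝ → ℝ} (hφ : Continuous φ)
    (hφ0 : ∀ t : ℝ, n * |t| ≤ 1 → φ t = 0) {g : EuclideanSpace ℝ (Fin d) × ℝ → ℝ} {C : ℝ}
    (hg : ContinuousOn g (upperHalf d)) (hb : ∀ q ∈ upperHalf d, |g q| ≤ C) :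
    IntegrableOn (fun q => q.2 ^ σ * (φ (Kext d s ν q) * g q)) (upperHalf d) := by
  obtain ⟨R, _, hR⟩ := exists_radius_Kext hs hν n
  obtain ⟨M, hM⟩ := exists_bound_Kext hs hsd hν
  obtain ⟨B, hB⟩ := (isCompact_Icc (a := -M) (b := M)).exists_bound_of_continuousOn
    hφ.continuousOn
  refine integrableOn_rpow_mul (C := B * C) (R := R) hσ
    ((continuousOn_comp_Kext hφ s hν).mul hg) (fun q hq => ?_)
    fun q hq hqR => by rw [hφ0 _ (hR q hq hqR), zero_mul]
  rw [abs_mul]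
  have h1 := hB _ (abs_le.1 (hM q hq).1)
  exact mul_le_mul h1 (hb q hq) (abs_nonneg _) ((norm_nonneg _).trans h1)

/-- `ξ² K_{s+2}` is the weighted vertical derivative of `K_s` up to a constant. -/
lemma continuousOn_pow_mul_Kext (k : ℕ) (s : ℝ) (hν : IsTestDensity ν) :
    ContinuousOn (fun q => q.2 ^ k * Kext d s ν q) (upperHalf d) :=
  (continuousOn_snd.pow k).mul (continuousOn_Kext s hν)

lemma abs_sq_mul (t u : ℝ) : |t ^ 2 * u| = t ^ 2 * |u| := by rw [abs_mul, abs_of_nonneg (sq_nonneg t)]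

lemma hasDerivAt_rpow_snd {q : EuclideanSpace ℝ (Fin d) × ℝ} (hq : q ∈ upperHalf d) (σ : ℝ) :
    HasDerivAt (fun t : ℝ => t ^ (σ + 1)) ((σ + 1) * q.2 ^ σ) q.2 := by
  have := Real.hasDerivAt_rpow_const (x := q.2) (p := σ + 1) (Or.inl (ne_of_gt hq))
  rwa [add_sub_cancel_right] at this

lemma rpow_snd_add_one {q : EuclideanSpace ℝ (Fin d) × ℝ} (hq : q ∈ upperHalf d) (σ : ℝ) :
    q.2 ^ (σ + 1) = q.2 ^ σ * q.2 := Real.rpow_add_one (ne_of_gt hq) σ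

lemma rpow_snd_add_two {q : EuclideanSpace ℝ (Fin d) × ℝ} (hq : q ∈ upperHalf d) (σ : ℝ) :
    q.2 ^ (σ + 2) = q.2 ^ σ * q.2 ^ 2 := by
  have hq' : (0 : ℝ) < q.2 := hq
  rw [Real.rpow_add hq', Real.rpow_two]

lemma integrableOn_truncSq (hσ : -1 < σ) (hs : 0 < s) (hsd : s < d) (hν : IsTestDensity ν)
    (n : ℕ) : IntegrableOn (fun q => q.2 ^ σ * truncSq n (Kext d s ν q)) (upperHalf d) := by
  have := integrableOn_rpow_mul_comp_Kext hσ hs hsd hν (continuous_truncSq n)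
    (fun t => truncSq_eq_zero) (g := fun _ => 1) continuousOn_const (C := 1) (by simp)
  simpa using this

lemma integrableOn_truncId_mul (hσ : -1 < σ) (hs : 0 < s) (hsd : s < d) (hν : IsTestDensity ν)
    (n : ℕ) : IntegrableOn
      (fun q => q.2 ^ σ * (truncId n (Kext d s ν q) * (q.2 ^ 2 * Kext d (s + 2) ν q)))
      (upperHalf d) := by
  obtain ⟨M, hM⟩ := exists_bound_Kext hs hsd hν
  exact integrableOn_rpow_mul_comp_Kext hσ hs hsd hν (continuous_truncId n)
    (fun t => truncId_eq_zero) (continuousOn_pow_mul_Kext 2 _ hν)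
    fun q hq => (abs_sq_mul _ _).trans_le (hM q hq).2.1

lemma integral_truncId_mul (hσ : -1 < σ) (hs : 0 < s) (hsd : s < d) (hν : IsTestDensity ν)
    (n : ℕ) :
    s * ∫ q in upperHalf d,
        q.2 ^ σ * (truncId n (Kext d s ν q) * (q.2 ^ 2 * Kext d (s + 2) ν q)) =
      (σ + 1) * ∫ q in upperHalf d, q.2 ^ σ * truncSq n (Kext d s ν q) := by
  obtain ⟨R, _, hR⟩ := exists_radius_Kext hs hν n
  obtain ⟨M, hM⟩ := exists_bound_Kext hs hsd hν
  have hi := ((integrableOn_truncSq hσ hs hsd hν n).const_mul (σ + 1)).sub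
    ((integrableOn_truncId_mul hσ hs hsd hν n).const_mul s)
  have h := integral_vertical_deriv_eq_zero (κ := σ + 1) (C := M ^ 2 / 2) (R := R)
    (G := fun q => q.2 ^ (σ + 1) * truncSq n (Kext d s ν q)) (by linarith)
    (fun x => by simp [Real.zero_rpow (by linarith : σ + 1 ≠ 0)]) (fun q hq => ?_)
    (fun q hq => ?_) (fun q hq hqR => by rw [truncSq_eq_zero (hR q hq hqR), mul_zero]) hi
  · rw [integral_sub' ((integrableOn_truncSq hσ hs hsd hν n).const_mul (σ + 1))
      ((integrableOn_truncId_mul hσ hs hsd hν n).const_mul s), integral_const_mul,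
      integral_const_mul] at h
    linarith
  · refine ((hasDerivAt_rpow_snd hq σ).mul
      (hasDerivAt_truncSq.comp q.2 (hasDerivAt_Kext_vertical s hν hq))).congr_deriv ?_
    simp only [Function.comp_apply, Pi.sub_apply]
    rw [rpow_snd_add_one hq]
    ring
  · have h1 := (hM q hq).1
    rw [abs_mul, abs_of_nonneg (Real.rpow_nonneg (le_of_lt hq) _), abs_of_nonneg truncSq_nonneg,
      mul_comm]
    refine mul_le_mul_of_nonneg_right (truncSq_le.trans ?_) (Real.rpow_nonneg (le_of_lt hq) _)
    have := sq_le_sq' (abs_le.1 h1).1 (abs_le.1 h1).2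
    linarith

lemma integrableOn_cutoff_mul_sq (hσ : -1 < σ) (hs : 0 < s) (hsd : s < d) (hν : IsTestDensity ν)
    (n : ℕ) : IntegrableOn
      (fun q => q.2 ^ σ * (cutoff n (Kext d s ν q) * (q.2 ^ 2 * Kext d (s + 2) ν q) ^ 2))
      (upperHalf d) := by
  obtain ⟨M, hM⟩ := exists_bound_Kext hs hsd hν
  refine integrableOn_rpow_mul_comp_Kext (C := M ^ 2) hσ hs hsd hν (continuous_cutoff n)
    (fun t => cutoff_eq_zero) ((continuousOn_pow_mul_Kext 2 _ hν).pow 2) fun q hq => ?_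
  rw [abs_pow, abs_sq_mul]
  exact pow_le_pow_left₀ (by positivity) (hM q hq).2.1 2

lemma integrableOn_truncId_mul_pow_four (hσ : -1 < σ) (hs : 0 < s) (hsd : s < d)
    (hν : IsTestDensity ν) (n : ℕ) : IntegrableOn
      (fun q => q.2 ^ σ * (truncId n (Kext d s ν q) * (q.2 ^ 4 * Kext d (s + 4) ν q)))
      (upperHalf d) := by
  obtain ⟨M, hM⟩ := exists_bound_Kext hs hsd hν
  refine integrableOn_rpow_mul_comp_Kext (C := M) hσ hs hsd hν (continuous_truncId n)
    (fun t => truncId_eq_zero) (continuousOn_pow_mul_Kext 4 _ hν) fun q hq => ?_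
  rw [abs_mul, abs_of_nonneg (by positivity)]
  exact (hM q hq).2.2

lemma integral_cutoff_mul_sq (hσ : -1 < σ) (hs : 0 < s) (hsd : s < d) (hν : IsTestDensity ν)
    (n : ℕ) :
    s * ∫ q in upperHalf d,
        q.2 ^ σ * (cutoff n (Kext d s ν q) * (q.2 ^ 2 * Kext d (s + 2) ν q) ^ 2) =
      (σ + 3) * (∫ q in upperHalf d,
        q.2 ^ σ * (truncId n (Kext d s ν q) * (q.2 ^ 2 * Kext d (s + 2) ν q))) -
      (s + 2) * ∫ q in upperHalf d,
        q.2 ^ σ * (truncId n (Kext d s ν q) * (q.2 ^ 4 * Kext d (s + 4) ν q)) := by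
  obtain ⟨R, _, hR⟩ := exists_radius_Kext hs hν n
  obtain ⟨M, hM⟩ := exists_bound_Kext hs hsd hν
  have i1 := (integrableOn_truncId_mul hσ hs hsd hν n).const_mul (σ + 3)
  have i2 := (integrableOn_cutoff_mul_sq hσ hs hsd hν n).const_mul s
  have i3 := (integrableOn_truncId_mul_pow_four hσ hs hsd hν n).const_mul (s + 2)
  have h := integral_vertical_deriv_eq_zero (κ := σ + 1) (C := M * M) (R := R)
    (G := fun q => q.2 ^ (σ + 1) *
      (truncId n (Kext d s ν q) * (q.2 ^ 2 * Kext d (s + 2) ν q))) (by linarith)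
    (fun x => by simp) (fun q hq => ?_)
    (fun q hq => ?_) (fun q hq hqR => by rw [truncId_eq_zero (hR q hq hqR)]; ring)
    ((i1.sub i2).sub i3)
  · rw [integral_sub' (i1.sub i2) i3, integral_sub' i1 i2, integral_const_mul,
      integral_const_mul, integral_const_mul] at h
    linarith
  · have hE := hasDerivAt_Kext_vertical (s + 2) hν hq
    rw [show s + 2 + 2 = s + 4 by ring] at hE
    refine ((hasDerivAt_rpow_snd hq σ).mul
      ((hasDerivAt_truncId.comp q.2 (hasDerivAt_Kext_vertical s hν hq)).mul
        (((hasDerivAt_id q.2).pow 2).mul hE))).congr_deriv ?_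
    simp only [Function.comp_apply, Pi.sub_apply, Pi.mul_apply, Pi.pow_apply, id]
    rw [rpow_snd_add_one hq]
    push_cast
    ring
  · have h1 := (hM q hq).1
    rw [abs_mul, abs_of_nonneg (Real.rpow_nonneg (le_of_lt hq) _), abs_mul, abs_sq_mul, mul_comm]
    exact mul_le_mul_of_nonneg_right (mul_le_mul (abs_truncId_le.trans h1) (hM q hq).2.1
      (by positivity) ((abs_nonneg _).trans h1)) (Real.rpow_nonneg (le_of_lt hq) _)

lemma exists_abs_Kext_le (hs : 0 < s) (hsd : s < d) (hν : IsTestDensity ν) :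
    ∃ M, ∀ q ∈ upperHalf d, |Kext d s ν q| ≤ M :=
  let ⟨M, hM⟩ := exists_bound_Kext hs hsd hν
  ⟨M, fun q hq => (hM q hq).1⟩

lemma integrableOn_truncId_mul_Kext (hσ : -1 < σ) (hs : 0 < s) (hsd : s < d)
    (hν : IsTestDensity ν) (hν' : IsTestDensity ν') (n : ℕ) : IntegrableOn
      (fun q => q.2 ^ σ * (truncId n (Kext d s ν q) * Kext d s ν' q)) (upperHalf d) := by
  obtain ⟨M, hM⟩ := exists_abs_Kext_le hs hsd hν'
  exact integrableOn_rpow_mul_comp_Kext hσ hs hsd hν (continuous_truncId n)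
    (fun t => truncId_eq_zero) (continuousOn_Kext s hν') hM

lemma integrableOn_cutoff_mul_Kext {ν'' : EuclideanSpace ℝ (Fin d) → ℝ} (hσ : -1 < σ) (hs : 0 < s)
    (hsd : s < d) (hν : IsTestDensity ν) (hν' : IsTestDensity ν') (hν'' : IsTestDensity ν'')
    (n : ℕ) : IntegrableOn
      (fun q => q.2 ^ σ * (cutoff n (Kext d s ν q) * (Kext d s ν' q * Kext d s ν'' q)))
      (upperHalf d) := by
  obtain ⟨M, hM⟩ := exists_abs_Kext_le hs hsd hν'
  obtain ⟨M', hM'⟩ := exists_abs_Kext_le hs hsd hν''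
  refine integrableOn_rpow_mul_comp_Kext (C := M * M') hσ hs hsd hν (continuous_cutoff n)
    (fun t => cutoff_eq_zero) ((continuousOn_Kext s hν').mul (continuousOn_Kext s hν''))
    fun q hq => ?_
  rw [abs_mul]
  exact mul_le_mul (hM q hq) (hM' q hq) (abs_nonneg _) ((abs_nonneg _).trans (hM q hq))

lemma integral_truncId_mul_Kext_partialDeriv (hσ : -1 < σ) (hs : 0 < s) (hsd : s < d)
    (hν : IsTestDensity ν) (hν' : IsTestDensity ν') (n : ℕ) (i : Fin d) :
    ∫ q in upperHalf d,
        q.2 ^ σ * (truncId n (Kext d s ν q) * Kext d s (partialDeriv i ν') q) =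
      -∫ q in upperHalf d, q.2 ^ σ *
        (cutoff n (Kext d s ν q) * (Kext d s (partialDeriv i ν) q * Kext d s ν' q)) := by
  have h := integral_horizontal_by_parts (d := d) (v := EuclideanSpace.single i 1)
    (f := fun q => truncId n (Kext d s ν q)) (w := fun t => t ^ σ)
    (f' := fun q => cutoff n (Kext d s ν q) * Kext d s (partialDeriv i ν) q)
    (g := Kext d s ν') (g' := Kext d s (partialDeriv i ν'))
    (fun q hq => ?_) (fun q hq => hasLineDerivAt_Kext s hν' hq i)
    (fun t ht => (Real.rpow_pos_of_pos ht σ).ne') ?_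
    (integrableOn_truncId_mul_Kext hσ hs hsd hν (hν'.partialDeriv i) n)
    (integrableOn_truncId_mul_Kext hσ hs hsd hν hν' n)
  · simpa only [mul_assoc] using h
  · have h1 := hasLineDerivAt_Kext s hν hq i
    have h2 : HasDerivAt (truncId n) (cutoff n (Kext d s ν q))
        (Kext d s ν (q.1 + (0 : ℝ) • EuclideanSpace.single i 1, q.2)) := by
      simpa using hasDerivAt_truncId (n := n) (t := Kext d s ν q)
    exact h2.comp (0 : ℝ) h1
  · simpa only [mul_assoc] using
      integrableOn_cutoff_mul_Kext hσ hs hsd hν (hν.partialDeriv i) hν' n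

/-- The weighted energy density `(ξ ∇_x K)² + (ξ ∂_ξ K)²`. -/
def energyDensity (d : ℕ) (s : ℝ) (ν : EuclideanSpace ℝ (Fin d) → ℝ)
    (q : EuclideanSpace ℝ (Fin d) × ℝ) : ℝ :=
  ∑ i, (q.2 * Kext d s (partialDeriv i ν) q) ^ 2 + (s * (q.2 ^ 2 * Kext d (s + 2) ν q)) ^ 2

lemma energyDensity_nonneg (q : EuclideanSpace ℝ (Fin d) × ℝ) : 0 ≤ energyDensity d s ν q := by
  unfold energyDensity
  positivity

lemma integrableOn_cutoff_mul_partialDeriv (hσ : -1 < σ) (hs : 0 < s) (hsd : s < d)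
    (hν : IsTestDensity ν) (n : ℕ) (i : Fin d) :
    IntegrableOn (fun q => q.2 ^ σ * (cutoff n (Kext d s ν q) *
      (q.2 * Kext d s (partialDeriv i ν) q) ^ 2)) (upperHalf d) := by
  refine (integrableOn_cutoff_mul_Kext (σ := σ + 2) (by linarith) hs hsd hν (hν.partialDeriv i)
    (hν.partialDeriv i) n).congr_fun (fun q hq => ?_) measurableSet_upperHalf
  simp only [rpow_snd_add_two hq]
  ring

lemma integrableOn_cutoff_mul_energyDensity (hσ : -1 < σ) (hs : 0 < s) (hsd : s < d)
    (hν : IsTestDensity ν) (n : ℕ) :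
    IntegrableOn (fun q => q.2 ^ σ * (cutoff n (Kext d s ν q) * energyDensity d s ν q))
      (upperHalf d) := by
  have h := (integrable_finsetSum Finset.univ fun i _ =>
    integrableOn_cutoff_mul_partialDeriv hσ hs hsd hν n i).add
      ((integrableOn_cutoff_mul_sq hσ hs hsd hν n).const_mul (s ^ 2))
  refine h.congr (Eventually.of_forall fun q => ?_)
  simp only [energyDensity, Pi.add_apply, mul_add, Finset.mul_sum]
  ring

lemma integral_cutoff_mul_energyDensity (hσ : -1 < σ) (hs : 0 < s) (hsd : s < d)
    (hν : IsTestDensity ν) (n : ℕ) :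
    ∫ q in upperHalf d, q.2 ^ σ * (cutoff n (Kext d s ν q) * energyDensity d s ν q) =
      (d + 1 - s + σ) * (σ + 1) * ∫ q in upperHalf d, q.2 ^ σ * truncSq n (Kext d s ν q) := by
  have h1 : ∀ i, ∫ q in upperHalf d, q.2 ^ σ * (cutoff n (Kext d s ν q) *
      (q.2 * Kext d s (partialDeriv i ν) q) ^ 2) = -∫ q in upperHalf d, q.2 ^ (σ + 2) *
        (truncId n (Kext d s ν q) * Kext d s (partialDeriv i (partialDeriv i ν)) q) := by
    intro i
    rw [integral_truncId_mul_Kext_partialDeriv (by linarith) hs hsd hν (hν.partialDeriv i), neg_neg]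
    refine setIntegral_congr_fun measurableSet_upperHalf fun q hq => ?_
    simp only [rpow_snd_add_two hq]
    ring
  have h2 : ∫ q in upperHalf d, q.2 ^ σ * (cutoff n (Kext d s ν q) * energyDensity d s ν q) =
      ∑ i, (∫ q in upperHalf d, q.2 ^ σ * (cutoff n (Kext d s ν q) *
        (q.2 * Kext d s (partialDeriv i ν) q) ^ 2)) + s ^ 2 * ∫ q in upperHalf d,
        q.2 ^ σ * (cutoff n (Kext d s ν q) * (q.2 ^ 2 * Kext d (s + 2) ν q) ^ 2) := by
    rw [← integral_finsetSum _ fun i _ => integrableOn_cutoff_mul_partialDeriv hσ hs hsd hν n i,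
      ← integral_const_mul, ← integral_add (integrable_finsetSum _ fun i _ =>
        integrableOn_cutoff_mul_partialDeriv hσ hs hsd hν n i)
        ((integrableOn_cutoff_mul_sq hσ hs hsd hν n).const_mul (s ^ 2))]
    refine integral_congr_ae (Eventually.of_forall fun q => ?_)
    simp only [energyDensity, mul_add, Finset.mul_sum]
    ring
  have h3 : ∑ i, (∫ q in upperHalf d, q.2 ^ (σ + 2) *
      (truncId n (Kext d s ν q) * Kext d s (partialDeriv i (partialDeriv i ν)) q)) =
      s * (s + 2 - d) * (∫ q in upperHalf d,
        q.2 ^ σ * (truncId n (Kext d s ν q) * (q.2 ^ 2 * Kext d (s + 2) ν q))) -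
      s * (s + 2) * ∫ q in upperHalf d,
        q.2 ^ σ * (truncId n (Kext d s ν q) * (q.2 ^ 4 * Kext d (s + 4) ν q)) := by
    rw [← integral_finsetSum _ fun i _ => integrableOn_truncId_mul_Kext (by linarith) hs hsd hν
        ((hν.partialDeriv i).partialDeriv i) n, ← integral_const_mul, ← integral_const_mul,
      ← integral_sub ((integrableOn_truncId_mul hσ hs hsd hν n).const_mul _)
        ((integrableOn_truncId_mul_pow_four hσ hs hsd hν n).const_mul _)]
    refine setIntegral_congr_fun measurableSet_upperHalf fun q hq => ?_
    simp only [← Finset.mul_sum]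
    rw [sum_Kext_partialDeriv_partialDeriv s hν hq, rpow_snd_add_two hq]
    ring
  rw [h2, Finset.sum_congr rfl fun i _ => h1 i, Finset.sum_neg_distrib, h3]
  linear_combination s * integral_cutoff_mul_sq hσ hs hsd hν n +
    (σ + 1 + d - s) * integral_truncId_mul hσ hs hsd hν n

end TruncatedIdentities

section Limits

lemma integrable_of_tendsto_of_integral_le {α : Type*} [MeasurableSpace α] {ρ : Measure α}
    {f : ℕ → α → ℝ} {g : α → ℝ} {B : ℝ} (hf : ∀ n, Integrable (f n) ρ)
    (h0 : ∀ n, ∀ᵐ a ∂ρ, 0 ≤ f n a) (hB : ∀ n, ∫ a, f n a ∂ρ ≤ B)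
    (hlim : ∀ᵐ a ∂ρ, Tendsto (fun n => f n a) atTop (𝓝 (g a))) : Integrable g ρ := by
  refine ⟨aestronglyMeasurable_of_tendsto_ae atTop (fun n => (hf n).1) hlim, ?_⟩
  have h1 : ∀ᵐ a ∂ρ, ‖g a‖ₑ = liminf (fun n => ‖f n a‖ₑ) atTop := by
    filter_upwards [hlim] with a ha
    exact (ha.enorm.liminf_eq).symm
  rw [HasFiniteIntegral, lintegral_congr_ae h1]
  refine (lintegral_liminf_le' fun n => (hf n).1.enorm).trans_lt ?_
  refine (liminf_le_of_frequently_le' (x := ENNReal.ofReal B)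
    (Frequently.of_forall fun n => ?_)).trans_lt ENNReal.ofReal_lt_top
  have h2 : ∀ᵐ a ∂ρ, ‖f n a‖ₑ = ENNReal.ofReal (f n a) := by
    filter_upwards [h0 n] with a ha
    exact Real.enorm_of_nonneg ha
  rw [lintegral_congr_ae h2, ← ofReal_integral_eq_lintegral_ofReal (hf n) (h0 n)]
  exact ENNReal.ofReal_le_ofReal (hB n)

variable {d : ℕ} {s σ : ℝ} {ν : EuclideanSpace ℝ (Fin d) → ℝ}

/-- Square integrability on the upper half-space with weight `ξ ^ σ`. -/
def SqIntegrable (σ : ℝ) (f : EuclideanSpace ℝ (Fin d) × ℝ → ℝ) : Prop :=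
  IntegrableOn (fun q => q.2 ^ σ * f q ^ 2) (upperHalf d)

lemma SqIntegrable.of_sq_le {f g : EuclideanSpace ℝ (Fin d) × ℝ → ℝ}
    (hf : ContinuousOn f (upperHalf d))
    (hg : IntegrableOn (fun q => q.2 ^ σ * g q) (upperHalf d))
    (h : ∀ q ∈ upperHalf d, f q ^ 2 ≤ g q) : SqIntegrable σ f := by
  refine Integrable.mono' hg (((continuousOn_rpow_snd σ).mul (hf.pow 2)).aestronglyMeasurable
    measurableSet_upperHalf) ?_
  filter_upwards [ae_restrict_mem measurableSet_upperHalf] with q hq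
  have h1 : 0 ≤ q.2 ^ σ := Real.rpow_nonneg (le_of_lt hq) _
  rw [Real.norm_of_nonneg (mul_nonneg h1 (sq_nonneg _))]
  exact mul_le_mul_of_nonneg_left (h q hq) h1

lemma SqIntegrable.integrableOn_mul {f g : EuclideanSpace ℝ (Fin d) × ℝ → ℝ}
    (hf : ContinuousOn f (upperHalf d)) (hg : ContinuousOn g (upperHalf d))
    (hf2 : SqIntegrable σ f) (hg2 : SqIntegrable σ g) :
    IntegrableOn (fun q => q.2 ^ σ * (f q * g q)) (upperHalf d) := by
  refine Integrable.mono' (Integrable.add hf2 hg2)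
    (((continuousOn_rpow_snd σ).mul (hf.mul hg)).aestronglyMeasurable measurableSet_upperHalf) ?_
  filter_upwards [ae_restrict_mem measurableSet_upperHalf] with q hq
  have h1 : 0 ≤ q.2 ^ σ := Real.rpow_nonneg (le_of_lt hq) _
  rw [norm_mul, Real.norm_of_nonneg h1, Real.norm_eq_abs, Pi.add_apply, ← mul_add]
  refine mul_le_mul_of_nonneg_left ?_ h1
  rw [abs_le]
  constructor <;> nlinarith [sq_nonneg (f q + g q), sq_nonneg (f q - g q)]

lemma SqIntegrable.add {f g : EuclideanSpace ℝ (Fin d) × ℝ → ℝ}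
    (hf : ContinuousOn f (upperHalf d)) (hg : ContinuousOn g (upperHalf d))
    (hf2 : SqIntegrable σ f) (hg2 : SqIntegrable σ g) : SqIntegrable σ fun q => f q + g q := by
  refine (Integrable.add (Integrable.add hf2 hg2)
    ((SqIntegrable.integrableOn_mul hf hg hf2 hg2).const_mul 2)).congr
      (Eventually.of_forall fun q => ?_)
  simp only [Pi.add_apply]
  ring

lemma SqIntegrable.const_mul {f : EuclideanSpace ℝ (Fin d) × ℝ → ℝ} (hf : SqIntegrable σ f)
    (c : ℝ) : SqIntegrable σ fun q => c * f q :=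
  (Integrable.const_mul hf (c ^ 2)).congr (Eventually.of_forall fun q => by ring)

lemma SqIntegrable.congr {f g : EuclideanSpace ℝ (Fin d) × ℝ → ℝ} (hf : SqIntegrable σ f)
    (h : ∀ q ∈ upperHalf d, f q = g q) : SqIntegrable σ g :=
  IntegrableOn.congr_fun hf (fun q hq => by simp only [h q hq]) measurableSet_upperHalf

lemma SqIntegrable.sum {ι : Type*} {t : Finset ι} {f : ι → EuclideanSpace ℝ (Fin d) × ℝ → ℝ}
    (hf : ∀ i ∈ t, ContinuousOn (f i) (upperHalf d)) (hf2 : ∀ i ∈ t, SqIntegrable σ (f i)) :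
    SqIntegrable σ fun q => ∑ i ∈ t, f i q := by
  classical
  induction t using Finset.induction_on with
  | empty => simp [SqIntegrable, IntegrableOn]
  | insert a t ha ih =>
    simp only [Finset.sum_insert ha]
    simp only [Finset.mem_insert, forall_eq_or_imp] at hf hf2
    exact SqIntegrable.add hf.1 (continuousOn_finsetSum _ hf.2) hf2.1 (ih hf.2 hf2.2)

lemma tendsto_cutoff_mul (hν : IsTestDensity ν) (s : ℝ)
    {g : EuclideanSpace ℝ (Fin d) × ℝ → ℝ}
    (hg : ∀ q ∈ upperHalf d, s * q.2 * Kext d (s + 2) ν q = 0 →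
      (∀ i, Kext d s (partialDeriv i ν) q = 0) → g q = 0) :
    ∀ᵐ q ∂(volume.restrict (upperHalf d)),
      Tendsto (fun n => q.2 ^ σ * (cutoff n (Kext d s ν q) * g q)) atTop
        (𝓝 (q.2 ^ σ * g q)) := by
  filter_upwards [ae_Kext_eq_zero s hν, ae_restrict_mem measurableSet_upperHalf] with q h hq
  by_cases h0 : Kext d s ν q = 0
  · obtain ⟨h1, h2⟩ := h h0
    simp [hg q hq h1 h2]
  · simpa using ((tendsto_cutoff h0).mul_const (g q)).const_mul (q.2 ^ σ)

lemma integrableOn_energyDensity (hσ : -1 < σ) (hs : 0 < s) (hsd : s < d)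
    (hν : IsTestDensity ν) (hF : SqIntegrable σ (Kext d s ν)) :
    IntegrableOn (fun q => q.2 ^ σ * energyDensity d s ν q) (upperHalf d) ∧
    ∫ q in upperHalf d, q.2 ^ σ * energyDensity d s ν q =
      (d + 1 - s + σ) * (σ + 1) / 2 * ∫ q in upperHalf d, q.2 ^ σ * Kext d s ν q ^ 2 := by
  have hpos : ∀ q ∈ upperHalf d, 0 ≤ q.2 ^ σ := fun q hq => Real.rpow_nonneg (le_of_lt hq) _
  have hlim := tendsto_cutoff_mul (σ := σ) hν s (g := energyDensity d s ν) fun q _ h1 h2 => by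
    have : s * (q.2 ^ 2 * Kext d (s + 2) ν q) = 0 := by linear_combination q.2 * h1
    simp [energyDensity, h2, this]
  have hc : 0 ≤ (d + 1 - s + σ) * (σ + 1) := mul_nonneg (by linarith) (by linarith)
  have hE : IntegrableOn (fun q => q.2 ^ σ * energyDensity d s ν q) (upperHalf d) := by
    refine integrable_of_tendsto_of_integral_le
      (fun n => integrableOn_cutoff_mul_energyDensity hσ hs hsd hν n) (fun n => ?_) (fun n => ?_)
      hlim (B := (d + 1 - s + σ) * (σ + 1) * ∫ q in upperHalf d, q.2 ^ σ * Kext d s ν q ^ 2)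
    · filter_upwards [ae_restrict_mem measurableSet_upperHalf] with q hq
      exact mul_nonneg (hpos q hq) (mul_nonneg cutoff_nonneg (energyDensity_nonneg q))
    · rw [integral_cutoff_mul_energyDensity hσ hs hsd hν n]
      refine mul_le_mul_of_nonneg_left ?_ hc
      refine setIntegral_mono_on (integrableOn_truncSq hσ hs hsd hν n) hF measurableSet_upperHalf
        fun q hq => mul_le_mul_of_nonneg_left ?_ (hpos q hq)
      exact truncSq_le.trans (by linarith [sq_nonneg (Kext d s ν q)])
  refine ⟨hE, ?_⟩
  have h1 : Tendsto (fun n => ∫ q in upperHalf d,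
      q.2 ^ σ * (cutoff n (Kext d s ν q) * energyDensity d s ν q)) atTop
      (𝓝 (∫ q in upperHalf d, q.2 ^ σ * energyDensity d s ν q)) := by
    refine tendsto_integral_of_dominated_convergence _
      (fun n => (integrableOn_cutoff_mul_energyDensity hσ hs hsd hν n).1) hE (fun n => ?_) hlim
    filter_upwards [ae_restrict_mem measurableSet_upperHalf] with q hq
    rw [Real.norm_of_nonneg (mul_nonneg (hpos q hq)
      (mul_nonneg cutoff_nonneg (energyDensity_nonneg q)))]
    exact mul_le_mul_of_nonneg_left
      (mul_le_of_le_one_left (energyDensity_nonneg q) cutoff_le_one) (hpos q hq)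
  have h2 : Tendsto (fun n => ∫ q in upperHalf d, q.2 ^ σ * truncSq n (Kext d s ν q)) atTop
      (𝓝 (∫ q in upperHalf d, q.2 ^ σ * (Kext d s ν q ^ 2 / 2))) := by
    refine tendsto_integral_of_dominated_convergence _
      (fun n => (integrableOn_truncSq hσ hs hsd hν n).1) hF (fun n => ?_)
      (Eventually.of_forall fun q => (tendsto_truncSq _).const_mul _)
    filter_upwards [ae_restrict_mem measurableSet_upperHalf] with q hq
    rw [Real.norm_of_nonneg (mul_nonneg (hpos q hq) truncSq_nonneg)]
    exact mul_le_mul_of_nonneg_left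
      (truncSq_le.trans (by linarith [sq_nonneg (Kext d s ν q)])) (hpos q hq)
  simp only [integral_cutoff_mul_energyDensity hσ hs hsd hν] at h1
  rw [tendsto_nhds_unique h1 (h2.const_mul _)]
  simp only [mul_div_assoc', integral_div]
  ring

lemma SqIntegrable.vertical (hσ : -1 < σ) (hs : 0 < s) (hsd : s < d)
    (hν : IsTestDensity ν) (hF : SqIntegrable σ (Kext d s ν)) :
    SqIntegrable σ fun q => q.2 ^ 2 * Kext d (s + 2) ν q := by
  have h := SqIntegrable.of_sq_le (f := fun q => s * (q.2 ^ 2 * Kext d (s + 2) ν q))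
    ((continuousOn_pow_mul_Kext 2 _ hν).const_smul s)
    (integrableOn_energyDensity hσ hs hsd hν hF).1 fun q _ =>
      le_add_of_nonneg_left (by positivity)
  simpa [← mul_assoc, inv_mul_cancel₀ hs.ne'] using h.const_mul s⁻¹

lemma SqIntegrable.horizontal (hσ : -1 < σ) (hs : 0 < s) (hsd : s < d)
    (hν : IsTestDensity ν) (hF : SqIntegrable σ (Kext d s ν)) (i : Fin d) :
    SqIntegrable σ fun q => q.2 * Kext d s (partialDeriv i ν) q := by
  refine SqIntegrable.of_sq_le (continuousOn_snd.mul (continuousOn_Kext s (hν.partialDeriv i)))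
    (integrableOn_energyDensity hσ hs hsd hν hF).1 fun q _ => ?_
  unfold energyDensity
  have := Finset.single_le_sum (f := fun i => (q.2 * Kext d s (partialDeriv i ν) q) ^ 2)
    (fun i _ => sq_nonneg _) (Finset.mem_univ i)
  exact this.trans (le_add_of_nonneg_right (sq_nonneg _))

/-- A Hardy inequality for `F = K_s` and the vertical operator `λ F - ξ ∂_ξ F`. -/
lemma SqIntegrable.of_hardy {c : ℝ} (hc : 0 ≤ c) (hσ : -1 < σ) (hs : 0 < s) (hsd : s < d)
    (hν : IsTestDensity ν)
    (hH : SqIntegrable σ fun q => c * Kext d s ν q + s * (q.2 ^ 2 * Kext d (s + 2) ν q)) :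
    SqIntegrable σ (Kext d s ν) := by
  have hpos : ∀ q ∈ upperHalf d, 0 ≤ q.2 ^ σ := fun q hq => Real.rpow_nonneg (le_of_lt hq) _
  have hσ' : 0 < σ + 1 := by linarith
  have key : ∀ n, ∫ q in upperHalf d, q.2 ^ σ * truncSq n (Kext d s ν q) ≤
      2 / (σ + 1) ^ 2 * ∫ q in upperHalf d, q.2 ^ σ *
        (c * Kext d s ν q + s * (q.2 ^ 2 * Kext d (s + 2) ν q)) ^ 2 := by
    intro n
    have h1 := integral_truncId_mul hσ hs hsd hν n
    have h2 : s * ∫ q in upperHalf d,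
        q.2 ^ σ * (truncId n (Kext d s ν q) * (q.2 ^ 2 * Kext d (s + 2) ν q)) ≤
        (σ + 1) / 2 * (∫ q in upperHalf d, q.2 ^ σ * truncSq n (Kext d s ν q)) +
        (σ + 1)⁻¹ * ∫ q in upperHalf d, q.2 ^ σ *
        (c * Kext d s ν q + s * (q.2 ^ 2 * Kext d (s + 2) ν q)) ^ 2 := by
      have i1 := (integrableOn_truncSq hσ hs hsd hν n).const_mul ((σ + 1) / 2)
      have i2 := Integrable.const_mul hH (σ + 1)⁻¹
      rw [← integral_const_mul, ← integral_const_mul, ← integral_const_mul, ← integral_add i1 i2]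
      refine setIntegral_mono_on ((integrableOn_truncId_mul hσ hs hsd hν n).const_mul s)
        (i1.add i2) measurableSet_upperHalf fun q hq => ?_
      have h3 := sq_truncId_le (n := n) (t := Kext d s ν q)
      have h4 := truncId_mul_self_nonneg (n := n) (t := Kext d s ν q)
      set ψ := truncId n (Kext d s ν q)
      set E := q.2 ^ 2 * Kext d (s + 2) ν q
      set H := c * Kext d s ν q + s * E with hHdef
      have h5 : ψ * H ≤ (σ + 1) / 2 * truncSq n (Kext d s ν q) + (σ + 1)⁻¹ * H ^ 2 := by
        have h6 : 0 ≤ (σ + 1)⁻¹ * ((σ + 1) / 2 * ψ - H) ^ 2 := by positivity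
        have h7 : (σ + 1)⁻¹ * ((σ + 1) / 2 * ψ - H) ^ 2 =
            (σ + 1) / 4 * ψ ^ 2 - ψ * H + (σ + 1)⁻¹ * H ^ 2 := by
          field_simp
          ring
        nlinarith [mul_le_mul_of_nonneg_left h3 hσ'.le]
      have h8 : s * (ψ * E) ≤ ψ * H := by
        rw [hHdef]
        nlinarith [mul_nonneg hc h4]
      calc s * (q.2 ^ σ * (ψ * E)) = q.2 ^ σ * (s * (ψ * E)) := by ring
        _ ≤ q.2 ^ σ * ((σ + 1) / 2 * truncSq n (Kext d s ν q) + (σ + 1)⁻¹ * H ^ 2) :=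
          mul_le_mul_of_nonneg_left (h8.trans h5) (hpos q hq)
        _ = _ := by ring
    rw [h1] at h2
    set X := ∫ q in upperHalf d, q.2 ^ σ * truncSq n (Kext d s ν q)
    set Y := ∫ q in upperHalf d, q.2 ^ σ *
      (c * Kext d s ν q + s * (q.2 ^ 2 * Kext d (s + 2) ν q)) ^ 2
    have h3 : (σ + 1) / 2 * X ≤ (σ + 1)⁻¹ * Y := by linarith
    calc X = 2 / (σ + 1) * ((σ + 1) / 2 * X) := by field_simp
      _ ≤ 2 / (σ + 1) * ((σ + 1)⁻¹ * Y) := mul_le_mul_of_nonneg_left h3 (by positivity)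
      _ = _ := by field_simp
  have h := integrable_of_tendsto_of_integral_le (ρ := volume.restrict (upperHalf d))
    (fun n => integrableOn_truncSq hσ hs hsd hν n) (fun n => ?_) key
    (Eventually.of_forall fun q => (tendsto_truncSq (Kext d s ν q)).const_mul (q.2 ^ σ))
  · exact (h.const_mul 2).congr (Eventually.of_forall fun q => by simp only; ring)
  · filter_upwards [ae_restrict_mem measurableSet_upperHalf] with q hq
    exact mul_nonneg (hpos q hq) truncSq_nonneg

lemma integral_mul_vertical (hσ : -1 < σ) (hs : 0 < s) (hsd : s < d)
    (hν : IsTestDensity ν) (hF : SqIntegrable σ (Kext d s ν)) :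
    s * ∫ q in upperHalf d, q.2 ^ σ * (Kext d s ν q * (q.2 ^ 2 * Kext d (s + 2) ν q)) =
      (σ + 1) / 2 * ∫ q in upperHalf d, q.2 ^ σ * Kext d s ν q ^ 2 := by
  have hpos : ∀ q ∈ upperHalf d, 0 ≤ q.2 ^ σ := fun q hq => Real.rpow_nonneg (le_of_lt hq) _
  have h1 : Tendsto (fun n => ∫ q in upperHalf d,
      q.2 ^ σ * (truncId n (Kext d s ν q) * (q.2 ^ 2 * Kext d (s + 2) ν q))) atTop
      (𝓝 (∫ q in upperHalf d,
        q.2 ^ σ * (Kext d s ν q * (q.2 ^ 2 * Kext d (s + 2) ν q)))) := by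
    refine tendsto_integral_of_dominated_convergence _
      (fun n => (integrableOn_truncId_mul hσ hs hsd hν n).1)
      (SqIntegrable.integrableOn_mul (continuousOn_Kext s hν) (continuousOn_pow_mul_Kext 2 _ hν)
        hF (hF.vertical hσ hs hsd hν)).norm (fun n => Eventually.of_forall fun q => ?_)
      (Eventually.of_forall fun q => ((tendsto_truncId _).mul_const _).const_mul _)
    simp only [norm_mul]
    gcongr
    exact abs_truncId_le
  have h2 : Tendsto (fun n => ∫ q in upperHalf d, q.2 ^ σ * truncSq n (Kext d s ν q)) atTop
      (𝓝 (∫ q in upperHalf d, q.2 ^ σ * (Kext d s ν q ^ 2 / 2))) := by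
    refine tendsto_integral_of_dominated_convergence _
      (fun n => (integrableOn_truncSq hσ hs hsd hν n).1) hF (fun n => ?_)
      (Eventually.of_forall fun q => (tendsto_truncSq _).const_mul _)
    filter_upwards [ae_restrict_mem measurableSet_upperHalf] with q hq
    rw [Real.norm_of_nonneg (mul_nonneg (hpos q hq) truncSq_nonneg)]
    exact mul_le_mul_of_nonneg_left
      (truncSq_le.trans (by linarith [sq_nonneg (Kext d s ν q)])) (hpos q hq)
  have h3 := h1.const_mul s
  simp only [integral_truncId_mul hσ hs hsd hν] at h3
  rw [tendsto_nhds_unique h3 (h2.const_mul _)]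
  simp only [mul_div_assoc', integral_div]
  ring

/-- The Hessian identity `∬ ξ^σ |∇²U|² = ∬ ξ^σ (ΔU)²`, entry by entry. -/
lemma integral_hessian_sq_eq (hσ : -1 < σ) (hs : 0 < s) (hsd : s < d) (hν : IsTestDensity ν)
    (hA : ∀ i k, SqIntegrable σ (Kext d s (partialDeriv i (partialDeriv k ν)))) (i k : Fin d) :
    ∫ q in upperHalf d, q.2 ^ σ * Kext d s (partialDeriv i (partialDeriv k ν)) q ^ 2 =
      ∫ q in upperHalf d, q.2 ^ σ * (Kext d s (partialDeriv i (partialDeriv i ν)) q *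
        Kext d s (partialDeriv k (partialDeriv k ν)) q) := by
  have hdd : ∀ i k, IsTestDensity (partialDeriv i (partialDeriv k ν)) := fun i k =>
    (hν.partialDeriv k).partialDeriv i
  have e1 : ∀ n, ∫ q in upperHalf d, q.2 ^ σ * (cutoff n (Kext d s (partialDeriv i ν) q) *
      (Kext d s (partialDeriv k (partialDeriv i ν)) q *
        Kext d s (partialDeriv k (partialDeriv i ν)) q)) =
      ∫ q in upperHalf d, q.2 ^ σ * (cutoff n (Kext d s (partialDeriv i ν) q) *
      (Kext d s (partialDeriv i (partialDeriv i ν)) q *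
        Kext d s (partialDeriv k (partialDeriv k ν)) q)) := by
    intro n
    have h1 := integral_truncId_mul_Kext_partialDeriv hσ hs hsd (hν.partialDeriv i) (hdd k i) n k
    have h2 := integral_truncId_mul_Kext_partialDeriv hσ hs hsd (hν.partialDeriv i) (hdd k k) n i
    rw [partialDeriv_comm (hν.partialDeriv k), partialDeriv_comm hν i k, h1, neg_inj] at h2
    exact h2
  have lim : ∀ {g : EuclideanSpace ℝ (Fin d) × ℝ → ℝ},
      IntegrableOn (fun q => q.2 ^ σ * g q) (upperHalf d) → ContinuousOn g (upperHalf d) →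
      (∀ q, (∀ k, Kext d s (partialDeriv k (partialDeriv i ν)) q = 0) → g q = 0) →
      Tendsto (fun n => ∫ q in upperHalf d,
        q.2 ^ σ * (cutoff n (Kext d s (partialDeriv i ν) q) * g q)) atTop
        (𝓝 (∫ q in upperHalf d, q.2 ^ σ * g q)) := by
    intro g hg hgc hg0
    refine tendsto_integral_of_dominated_convergence _ (fun n => ?_) hg.norm
      (fun n => Eventually.of_forall fun q => ?_)
      (tendsto_cutoff_mul (hν.partialDeriv i) s fun q _ _ h => hg0 q h)
    · exact ((continuousOn_rpow_snd σ).mul ((continuousOn_comp_Kext (continuous_cutoff n) s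
        (hν.partialDeriv i)).mul hgc)).aestronglyMeasurable measurableSet_upperHalf
    · simp only [norm_mul]
      rw [Real.norm_of_nonneg cutoff_nonneg]
      gcongr
      exact mul_le_of_le_one_left (norm_nonneg _) cutoff_le_one
  have l1 := lim (SqIntegrable.integrableOn_mul (continuousOn_Kext s (hdd k i))
    (continuousOn_Kext s (hdd k i)) (hA k i) (hA k i))
    ((continuousOn_Kext s (hdd k i)).mul (continuousOn_Kext s (hdd k i)))
    fun q hq => by rw [hq k, zero_mul]
  have l2 := lim (SqIntegrable.integrableOn_mul (continuousOn_Kext s (hdd i i))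
    (continuousOn_Kext s (hdd k k)) (hA i i) (hA k k))
    ((continuousOn_Kext s (hdd i i)).mul (continuousOn_Kext s (hdd k k)))
    fun q hq => by rw [hq i, zero_mul]
  simp only [e1] at l1
  rw [partialDeriv_comm hν i k, ← tendsto_nhds_unique l1 l2]
  simp only [sq]

end Limits

section DensityIdentities

variable {d : ℕ} {b γ : ℝ} {ν : EuclideanSpace ℝ (Fin d) → ℝ}

lemma integrableOn_rpow_mul_sum_iff {ι : Type*} {t : Finset ι}
    {f : ι → EuclideanSpace ℝ (Fin d) × ℝ → ℝ} (hf : ∀ i ∈ t, ContinuousOn (f i) (upperHalf d))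
    (h0 : ∀ i ∈ t, ∀ q ∈ upperHalf d, 0 ≤ f i q) :
    IntegrableOn (fun q => q.2 ^ γ * ∑ i ∈ t, f i q) (upperHalf d) ↔
      ∀ i ∈ t, IntegrableOn (fun q => q.2 ^ γ * f i q) (upperHalf d) := by
  refine ⟨fun h i hi => ?_, fun h => ?_⟩
  · refine Integrable.mono' h (((continuousOn_rpow_snd γ).mul (hf i hi)).aestronglyMeasurable
      measurableSet_upperHalf) ?_
    filter_upwards [ae_restrict_mem measurableSet_upperHalf] with q hq
    have h1 : 0 ≤ q.2 ^ γ := Real.rpow_nonneg (le_of_lt hq) _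
    rw [Real.norm_of_nonneg (mul_nonneg h1 (h0 i hi q hq))]
    exact mul_le_mul_of_nonneg_left
      (Finset.single_le_sum (f := fun i => f i q) (fun i hi => h0 i hi q hq) hi) h1
  · simp only [Finset.mul_sum]
    exact integrable_finsetSum t h

lemma integral_rpow_mul_sum {ι : Type*} {t : Finset ι}
    {f : ι → EuclideanSpace ℝ (Fin d) × ℝ → ℝ}
    (h : ∀ i ∈ t, IntegrableOn (fun q => q.2 ^ γ * f i q) (upperHalf d)) :
    ∫ q in upperHalf d, q.2 ^ γ * ∑ i ∈ t, f i q =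
      ∑ i ∈ t, ∫ q in upperHalf d, q.2 ^ γ * f i q := by
  simp only [Finset.mul_sum]
  exact integral_finsetSum t h

lemma sqIntegrable_const_mul_iff {f : EuclideanSpace ℝ (Fin d) × ℝ → ℝ} {c : ℝ} (hc : c ≠ 0) :
    SqIntegrable γ (fun q => c * f q) ↔ SqIntegrable γ f :=
  ⟨fun h => by simpa [← mul_assoc, inv_mul_cancel₀ hc] using h.const_mul c⁻¹,
    fun h => h.const_mul c⟩

lemma IsTestDensity.partialDeriv₂ (hν : IsTestDensity ν) (i k : Fin d) :
    IsTestDensity (_root_.partialDeriv i (_root_.partialDeriv k ν)) :=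
  (hν.partialDeriv k).partialDeriv i

lemma SqIntegrable.of_mul_horizontal (hγ : -1 < γ) (hb : 0 < b) (hbd : b + 2 < d)
    (hν : IsTestDensity ν)
    (h : ∀ i, SqIntegrable γ fun q => q.2 * Kext d (b + 2) (partialDeriv i ν) q)
    (i k : Fin d) : SqIntegrable γ (Kext d b (partialDeriv i (partialDeriv k ν))) := by
  have h1 : SqIntegrable (γ + 2) (Kext d (b + 2) (partialDeriv k ν)) :=
    IntegrableOn.congr_fun (h k) (fun q hq => by simp only [rpow_snd_add_two hq]; ring)
      measurableSet_upperHalf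
  have h2 := h1.horizontal (by linarith) (by linarith) hbd (hν.partialDeriv k) i
  have h3 : SqIntegrable γ fun q =>
      q.2 ^ 2 * Kext d (b + 2) (partialDeriv i (partialDeriv k ν)) q :=
    IntegrableOn.congr_fun h2 (fun q hq => by simp only [rpow_snd_add_two hq]; ring)
      measurableSet_upperHalf
  exact SqIntegrable.of_hardy le_rfl hγ hb (by linarith) (hν.partialDeriv₂ i k)
    (by simpa using h3.const_mul b)

lemma sum_Kext_partialDeriv_partialDeriv_eq (b : ℝ) (hν : IsTestDensity ν)
    {q : EuclideanSpace ℝ (Fin d) × ℝ} (hq : q ∈ upperHalf d) :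
    ∑ i, Kext d b (partialDeriv i (partialDeriv i ν)) q =
      -b * ((d - b - 2) * Kext d (b + 2) ν q +
        (b + 2) * (q.2 ^ 2 * Kext d (b + 2 + 2) ν q)) := by
  rw [sum_Kext_partialDeriv_partialDeriv b hν hq, show b + 2 + 2 = b + 4 by ring]
  ring

lemma SqIntegrable.of_hessian (hγ : -1 < γ) (hb : 0 < b) (hbd : b + 2 < d)
    (hν : IsTestDensity ν)
    (h : ∀ i, SqIntegrable γ (Kext d b (partialDeriv i (partialDeriv i ν)))) :
    SqIntegrable γ (Kext d (b + 2) ν) := by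
  have h1 := SqIntegrable.sum (t := Finset.univ)
    (fun i _ => continuousOn_Kext b (hν.partialDeriv₂ i i)) fun i _ => h i
  refine SqIntegrable.of_hardy (c := d - b - 2) (by linarith) hγ (by linarith) hbd hν ?_
  exact (sqIntegrable_const_mul_iff (neg_ne_zero.2 hb.ne')).1
    (h1.congr fun q hq => sum_Kext_partialDeriv_partialDeriv_eq b hν hq)

/-- The squared norm of the horizontal Hessian of `K_b`. -/
def hessianDensity (d : ℕ) (b : ℝ) (ν : EuclideanSpace ℝ (Fin d) → ℝ)
    (q : EuclideanSpace ℝ (Fin d) × ℝ) : ℝ :=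
  ∑ i, ∑ k, Kext d b (partialDeriv i (partialDeriv k ν)) q ^ 2

/-- The squared norm of the vertical derivative of the horizontal gradient of `K_b`. -/
def crossDensity (d : ℕ) (b : ℝ) (ν : EuclideanSpace ℝ (Fin d) → ℝ)
    (q : EuclideanSpace ℝ (Fin d) × ℝ) : ℝ :=
  ∑ i, (b * (q.2 * Kext d (b + 2) (partialDeriv i ν) q)) ^ 2

/-- The square of the second vertical derivative of `K_b`. -/
def verticalDensity (d : ℕ) (b : ℝ) (ν : EuclideanSpace ℝ (Fin d) → ℝ)
    (q : EuclideanSpace ℝ (Fin d) × ℝ) : ℝ :=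
  (b * (Kext d (b + 2) ν q - (b + 2) * (q.2 ^ 2 * Kext d (b + 2 + 2) ν q))) ^ 2

lemma hessianDensity_nonneg (q : EuclideanSpace ℝ (Fin d) × ℝ) : 0 ≤ hessianDensity d b ν q := by
  unfold hessianDensity
  positivity

lemma crossDensity_nonneg (q : EuclideanSpace ℝ (Fin d) × ℝ) : 0 ≤ crossDensity d b ν q := by
  unfold crossDensity
  positivity

lemma verticalDensity_nonneg (q : EuclideanSpace ℝ (Fin d) × ℝ) : 0 ≤ verticalDensity d b ν q :=
  sq_nonneg _

lemma continuousOn_hessianDensity (hν : IsTestDensity ν) :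
    ContinuousOn (hessianDensity d b ν) (upperHalf d) :=
  continuousOn_finsetSum _ fun i _ => continuousOn_finsetSum _ fun k _ =>
    (continuousOn_Kext b (hν.partialDeriv₂ i k)).pow 2

lemma continuousOn_crossDensity (hν : IsTestDensity ν) :
    ContinuousOn (crossDensity d b ν) (upperHalf d) :=
  continuousOn_finsetSum _ fun i _ => (continuousOn_const.mul
    (continuousOn_snd.mul (continuousOn_Kext (b + 2) (hν.partialDeriv i)))).pow 2

lemma continuousOn_verticalDensity (hν : IsTestDensity ν) :
    ContinuousOn (verticalDensity d b ν) (upperHalf d) :=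
  (continuousOn_const.mul ((continuousOn_Kext (b + 2) hν).sub
    (continuousOn_const.mul (continuousOn_pow_mul_Kext 2 _ hν)))).pow 2

lemma integrableOn_hessianDensity_iff_forall (hν : IsTestDensity ν) :
    IntegrableOn (fun q => q.2 ^ γ * hessianDensity d b ν q) (upperHalf d) ↔
      ∀ i k, SqIntegrable γ (Kext d b (partialDeriv i (partialDeriv k ν))) := by
  unfold hessianDensity
  rw [integrableOn_rpow_mul_sum_iff
    (f := fun i q => ∑ k, Kext d b (partialDeriv i (partialDeriv k ν)) q ^ 2)
    (fun i _ => continuousOn_finsetSum _ fun k _ =>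
      (continuousOn_Kext b (hν.partialDeriv₂ i k)).pow 2)
    fun i _ q _ => Finset.sum_nonneg fun _ _ => sq_nonneg _]
  simp only [Finset.mem_univ, forall_const]
  refine forall_congr' fun i => ?_
  rw [integrableOn_rpow_mul_sum_iff
    (f := fun k q => Kext d b (partialDeriv i (partialDeriv k ν)) q ^ 2)
    (fun k _ => (continuousOn_Kext b (hν.partialDeriv₂ i k)).pow 2) fun k _ q _ => sq_nonneg _]
  simp only [Finset.mem_univ, forall_const]
  rfl

lemma integrableOn_crossDensity_iff_forall (hb : b ≠ 0) (hν : IsTestDensity ν) :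
    IntegrableOn (fun q => q.2 ^ γ * crossDensity d b ν q) (upperHalf d) ↔
      ∀ i, SqIntegrable γ fun q => q.2 * Kext d (b + 2) (partialDeriv i ν) q := by
  unfold crossDensity
  rw [integrableOn_rpow_mul_sum_iff
    (f := fun i q => (b * (q.2 * Kext d (b + 2) (partialDeriv i ν) q)) ^ 2)
    (fun i _ => (continuousOn_const.mul
      (continuousOn_snd.mul (continuousOn_Kext (b + 2) (hν.partialDeriv i)))).pow 2)
    fun i _ q _ => sq_nonneg _]
  simp only [Finset.mem_univ, forall_const]
  exact forall_congr' fun i => sqIntegrable_const_mul_iff hb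

lemma integrableOn_crossDensity_iff (hγ : -1 < γ) (hb : 0 < b) (hbd : b + 2 < d)
    (hν : IsTestDensity ν) :
    IntegrableOn (fun q => q.2 ^ γ * crossDensity d b ν q) (upperHalf d) ↔
      SqIntegrable γ (Kext d (b + 2) ν) := by
  rw [integrableOn_crossDensity_iff_forall hb.ne' hν]
  exact ⟨fun h => SqIntegrable.of_hessian hγ hb hbd hν fun i =>
    SqIntegrable.of_mul_horizontal hγ hb hbd hν h i i,
    fun h => h.horizontal hγ (by linarith) hbd hν⟩

lemma integrableOn_hessianDensity_iff (hγ : -1 < γ) (hb : 0 < b) (hbd : b + 2 < d)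
    (hν : IsTestDensity ν) :
    IntegrableOn (fun q => q.2 ^ γ * hessianDensity d b ν q) (upperHalf d) ↔
      SqIntegrable γ (Kext d (b + 2) ν) := by
  rw [integrableOn_hessianDensity_iff_forall hν]
  exact ⟨fun h => SqIntegrable.of_hessian hγ hb hbd hν fun i => h i i, fun h =>
    SqIntegrable.of_mul_horizontal hγ hb hbd hν (h.horizontal hγ (by linarith) hbd hν)⟩

lemma integrableOn_verticalDensity (hγ : -1 < γ) (hb : 0 < b) (hbd : b + 2 < d)
    (hν : IsTestDensity ν) (h : SqIntegrable γ (Kext d (b + 2) ν)) :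
    IntegrableOn (fun q => q.2 ^ γ * verticalDensity d b ν q) (upperHalf d) := by
  have h1 := ((h.vertical hγ (by linarith) hbd hν).const_mul (-(b + 2)))
  have h2 : SqIntegrable γ fun q =>
      b * (Kext d (b + 2) ν q - (b + 2) * (q.2 ^ 2 * Kext d (b + 2 + 2) ν q)) :=
    SqIntegrable.congr (SqIntegrable.const_mul (SqIntegrable.add
      (g := fun q => -(b + 2) * (q.2 ^ 2 * Kext d (b + 2 + 2) ν q)) (continuousOn_Kext (b + 2) hν)
      (continuousOn_const.mul (continuousOn_pow_mul_Kext 2 _ hν)) h h1) b) fun q _ => by ring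
  exact h2

lemma integrableOn_crossDensity_add_verticalDensity_iff (hγ : -1 < γ) (hb : 0 < b)
    (hbd : b + 2 < d) (hν : IsTestDensity ν) :
    IntegrableOn (fun q => q.2 ^ γ * (crossDensity d b ν q + verticalDensity d b ν q))
      (upperHalf d) ↔ SqIntegrable γ (Kext d (b + 2) ν) := by
  refine ⟨fun h => (integrableOn_crossDensity_iff hγ hb hbd hν).1 ?_, fun h => ?_⟩
  · refine Integrable.mono' h (((continuousOn_rpow_snd γ).mul
      (continuousOn_crossDensity hν)).aestronglyMeasurable measurableSet_upperHalf) ?_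
    filter_upwards [ae_restrict_mem measurableSet_upperHalf] with q hq
    have h1 : 0 ≤ q.2 ^ γ := Real.rpow_nonneg (le_of_lt hq) _
    rw [Real.norm_of_nonneg (mul_nonneg h1 (crossDensity_nonneg q))]
    exact mul_le_mul_of_nonneg_left (le_add_of_nonneg_right (verticalDensity_nonneg q)) h1
  · simp only [mul_add]
    exact ((integrableOn_crossDensity_iff hγ hb hbd hν).2 h).add
      (integrableOn_verticalDensity hγ hb hbd hν h)

lemma integral_sq_add_const_mul {f g : EuclideanSpace ℝ (Fin d) × ℝ → ℝ} (x y : ℝ)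
    (hf : ContinuousOn f (upperHalf d)) (hg : ContinuousOn g (upperHalf d))
    (hf2 : SqIntegrable γ f) (hg2 : SqIntegrable γ g) :
    ∫ q in upperHalf d, q.2 ^ γ * (x * f q + y * g q) ^ 2 =
      x ^ 2 * (∫ q in upperHalf d, q.2 ^ γ * f q ^ 2) +
      2 * x * y * (∫ q in upperHalf d, q.2 ^ γ * (f q * g q)) +
      y ^ 2 * ∫ q in upperHalf d, q.2 ^ γ * g q ^ 2 := by
  have h1 := Integrable.const_mul hf2 (x ^ 2)
  have h2 := (SqIntegrable.integrableOn_mul hf hg hf2 hg2).const_mul (2 * x * y)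
  have h3 := Integrable.const_mul hg2 (y ^ 2)
  have h12 : Integrable (fun q => x ^ 2 * (q.2 ^ γ * f q ^ 2) +
      2 * x * y * (q.2 ^ γ * (f q * g q))) (volume.restrict (upperHalf d)) := h1.add h2
  rw [← integral_const_mul, ← integral_const_mul, ← integral_const_mul, ← integral_add h1 h2,
    ← integral_add h12 h3]
  exact integral_congr_ae (Eventually.of_forall fun q => by simp only; ring)

lemma integral_hessianDensity (hγ : -1 < γ) (hb : 0 < b) (hbd : b + 2 < d)
    (hν : IsTestDensity ν) (h : SqIntegrable γ (Kext d (b + 2) ν)) :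
    ∫ q in upperHalf d, q.2 ^ γ * hessianDensity d b ν q =
      b ^ 2 * ∫ q in upperHalf d, q.2 ^ γ * ((d - b - 2) * Kext d (b + 2) ν q +
        (b + 2) * (q.2 ^ 2 * Kext d (b + 2 + 2) ν q)) ^ 2 := by
  have hA := (integrableOn_hessianDensity_iff_forall hν).1
    ((integrableOn_hessianDensity_iff hγ hb hbd hν).2 h)
  have hc : ∀ i, ContinuousOn (Kext d b (partialDeriv i (partialDeriv i ν))) (upperHalf d) :=
    fun i => continuousOn_Kext b (hν.partialDeriv₂ i i)
  have h1 : ∫ q in upperHalf d, q.2 ^ γ * hessianDensity d b ν q =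
      ∑ i, ∑ k, ∫ q in upperHalf d,
        q.2 ^ γ * Kext d b (partialDeriv i (partialDeriv k ν)) q ^ 2 := by
    unfold hessianDensity
    rw [integral_rpow_mul_sum fun i _ => (integrableOn_rpow_mul_sum_iff
      (f := fun k q => Kext d b (partialDeriv i (partialDeriv k ν)) q ^ 2)
      (fun k _ => (continuousOn_Kext b (hν.partialDeriv₂ i k)).pow 2)
      fun k _ q _ => sq_nonneg _).2 fun k _ => hA i k]
    exact Finset.sum_congr rfl fun i _ => integral_rpow_mul_sum fun k _ => hA i k
  rw [h1]
  simp only [integral_hessian_sq_eq hγ hb (by linarith) hν hA]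
  have h2 : ∀ i k, IntegrableOn (fun q => q.2 ^ γ *
      (Kext d b (partialDeriv i (partialDeriv i ν)) q *
        Kext d b (partialDeriv k (partialDeriv k ν)) q)) (upperHalf d) := fun i k =>
    SqIntegrable.integrableOn_mul (hc i) (hc k) (hA i i) (hA k k)
  rw [← integral_const_mul]
  simp only [← integral_finsetSum Finset.univ fun k _ => h2 _ k]
  rw [← integral_finsetSum Finset.univ fun i _ => integrable_finsetSum _ fun k _ => h2 i k]
  refine setIntegral_congr_fun measurableSet_upperHalf fun q hq => ?_
  simp only [← Finset.mul_sum, ← Finset.sum_mul]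
  rw [sum_Kext_partialDeriv_partialDeriv_eq b hν hq]
  ring

lemma integral_density_identity (hγ : -1 < γ) (hb : 0 < b) (hbd : b + 2 < d)
    (hν : IsTestDensity ν) (h : SqIntegrable γ (Kext d (b + 2) ν)) {m : ℝ}
    (hm : m = d + γ - 1 - b) (hm0 : m ≠ 0) :
    (∫ q in upperHalf d, q.2 ^ γ * hessianDensity d b ν q) +
        (∫ q in upperHalf d, q.2 ^ γ * crossDensity d b ν q) =
      (1 - γ / m ^ 2) * (∫ q in upperHalf d, q.2 ^ γ * (b * m * Kext d (b + 2) ν q) ^ 2) -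
        ∫ q in upperHalf d, q.2 ^ γ * (crossDensity d b ν q + verticalDensity d b ν q) := by
  have hE := h.vertical hγ (by linarith) hbd hν
  have cF := continuousOn_Kext (b + 2) hν
  have cE := continuousOn_pow_mul_Kext 2 (b + 2 + 2) hν
  have iC := (integrableOn_crossDensity_iff hγ hb hbd hν).2 h
  have iV := integrableOn_verticalDensity hγ hb hbd hν h
  have e1 := integral_hessianDensity hγ hb hbd hν h
  rw [integral_sq_add_const_mul _ _ cF cE h hE] at e1
  have e2 : ∫ q in upperHalf d, q.2 ^ γ * verticalDensity d b ν q =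
      ∫ q in upperHalf d, q.2 ^ γ * (b * Kext d (b + 2) ν q +
        (-(b * (b + 2))) * (q.2 ^ 2 * Kext d (b + 2 + 2) ν q)) ^ 2 :=
    integral_congr_ae (Eventually.of_forall fun q => by simp only [verticalDensity]; ring)
  rw [integral_sq_add_const_mul _ _ cF cE h hE] at e2
  have e3 : ∫ q in upperHalf d, q.2 ^ γ * (b * m * Kext d (b + 2) ν q) ^ 2 =
      (b * m) ^ 2 * ∫ q in upperHalf d, q.2 ^ γ * Kext d (b + 2) ν q ^ 2 := by
    rw [← integral_const_mul]
    exact integral_congr_ae (Eventually.of_forall fun q => by simp only; ring)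
  have e4 := integral_mul_vertical hγ (by linarith) hbd hν h
  have e5 := (integrableOn_energyDensity hγ (by linarith) hbd hν h).2
  have e6 : b ^ 2 * ∫ q in upperHalf d, q.2 ^ γ * energyDensity d (b + 2) ν q =
      (∫ q in upperHalf d, q.2 ^ γ * crossDensity d b ν q) +
      (b * (b + 2)) ^ 2 * ∫ q in upperHalf d, q.2 ^ γ *
        (q.2 ^ 2 * Kext d (b + 2 + 2) ν q) ^ 2 := by
    rw [← integral_const_mul, ← integral_const_mul,
      ← integral_add iC (Integrable.const_mul hE ((b * (b + 2)) ^ 2))]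
    refine integral_congr_ae (Eventually.of_forall fun q => ?_)
    simp only [energyDensity, crossDensity, mul_pow, ← Finset.mul_sum]
    ring
  have e7 : ∫ q in upperHalf d, q.2 ^ γ * (crossDensity d b ν q + verticalDensity d b ν q) =
      (∫ q in upperHalf d, q.2 ^ γ * crossDensity d b ν q) +
      ∫ q in upperHalf d, q.2 ^ γ * verticalDensity d b ν q := by
    simp only [mul_add]
    exact integral_add iC iV
  rw [e7, e2, e1, e3]
  have e8 : (1 - γ / m ^ 2) * ((b * m) ^ 2 * ∫ q in upperHalf d, q.2 ^ γ * Kext d (b + 2) ν q ^ 2) =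
      b ^ 2 * (m ^ 2 - γ) * ∫ q in upperHalf d, q.2 ^ γ * Kext d (b + 2) ν q ^ 2 := by
    field_simp
  rw [e8]
  rw [e5] at e6
  subst hm
  linear_combination (2 * b ^ 2 * (d - b - 3)) * e4 - 2 * e6

lemma integral_sum_density_identity {ι : Type*} [Fintype ι]
    {ν : ι → EuclideanSpace ℝ (Fin d) → ℝ} (hγ : -1 < γ) (hb : 0 < b) (hbd : b + 2 < d)
    (hν : ∀ J, IsTestDensity (ν J)) {m : ℝ} (hm : m = d + γ - 1 - b) (hm0 : m ≠ 0) :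
    (∫ q in upperHalf d, q.2 ^ γ * ∑ J, hessianDensity d b (ν J) q) +
        (∫ q in upperHalf d, q.2 ^ γ * ∑ J, crossDensity d b (ν J) q) =
      (1 - γ / m ^ 2) *
          (∫ q in upperHalf d, q.2 ^ γ * ∑ J, (b * m * Kext d (b + 2) (ν J) q) ^ 2) -
        ∫ q in upperHalf d, q.2 ^ γ *
          ∑ J, (crossDensity d b (ν J) q + verticalDensity d b (ν J) q) := by
  have i1 := integrableOn_rpow_mul_sum_iff (γ := γ) (t := Finset.univ)
    (f := fun J => hessianDensity d b (ν J)) (fun J _ => continuousOn_hessianDensity (hν J))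
    fun J _ q _ => hessianDensity_nonneg q
  have i2 := integrableOn_rpow_mul_sum_iff (γ := γ) (t := Finset.univ)
    (f := fun J => crossDensity d b (ν J)) (fun J _ => continuousOn_crossDensity (hν J))
    fun J _ q _ => crossDensity_nonneg q
  have i3 := integrableOn_rpow_mul_sum_iff (γ := γ) (t := Finset.univ)
    (f := fun J q => (b * m * Kext d (b + 2) (ν J) q) ^ 2)
    (fun J _ => (continuousOn_const.mul (continuousOn_Kext (b + 2) (hν J))).pow 2)
    fun J _ q _ => sq_nonneg _
  have i4 := integrableOn_rpow_mul_sum_iff (γ := γ) (t := Finset.univ)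
    (f := fun J q => crossDensity d b (ν J) q + verticalDensity d b (ν J) q)
    (fun J _ => (continuousOn_crossDensity (hν J)).add (continuousOn_verticalDensity (hν J)))
    fun J _ q _ => add_nonneg (crossDensity_nonneg q) (verticalDensity_nonneg q)
  have j1 := fun J => integrableOn_hessianDensity_iff hγ hb hbd (hν J)
  have j2 := fun J => integrableOn_crossDensity_iff hγ hb hbd (hν J)
  have j3 : ∀ J, IntegrableOn (fun q => q.2 ^ γ * (b * m * Kext d (b + 2) (ν J) q) ^ 2)
      (upperHalf d) ↔ SqIntegrable γ (Kext d (b + 2) (ν J)) :=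
    fun J => sqIntegrable_const_mul_iff (mul_ne_zero hb.ne' hm0)
  have j4 := fun J => integrableOn_crossDensity_add_verticalDensity_iff hγ hb hbd (hν J)
  simp only [j1, Finset.mem_univ, forall_const] at i1
  simp only [j2, Finset.mem_univ, forall_const] at i2
  simp only [j3, Finset.mem_univ, forall_const] at i3
  simp only [j4, Finset.mem_univ, forall_const] at i4
  by_cases h : ∀ J, SqIntegrable γ (Kext d (b + 2) (ν J))
  · rw [integral_rpow_mul_sum fun J _ => (j1 J).2 (h J),
      integral_rpow_mul_sum fun J _ => (j2 J).2 (h J),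
      integral_rpow_mul_sum fun J _ => (j3 J).2 (h J),
      integral_rpow_mul_sum fun J _ => (j4 J).2 (h J), Finset.mul_sum, ← Finset.sum_add_distrib,
      ← Finset.sum_sub_distrib]
    exact Finset.sum_congr rfl fun J _ =>
      integral_density_identity hγ hb hbd (hν J) (h J) hm hm0
  · rw [integral_undef (mt i1.1 h), integral_undef (mt i2.1 h), integral_undef (mt i3.1 h),
      integral_undef (mt i4.1 h)]
    ring

end DensityIdentities

section IteratedDerivatives

variable {d : ℕ} {b c γ : ℝ} {ν : EuclideanSpace ℝ (Fin d) → ℝ}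
  {f : EuclideanSpace ℝ (Fin d) × ℝ → ℝ} {q : EuclideanSpace ℝ (Fin d) × ℝ}

lemma fderiv_eq_of_eqOn_upperHalf {g : EuclideanSpace ℝ (Fin d) × ℝ → ℝ}
    (h : ∀ q ∈ upperHalf d, f q = g q) (hq : q ∈ upperHalf d) :
    fderiv ℝ f q = fderiv ℝ g q :=
  Filter.EventuallyEq.fderiv_eq (eventually_of_mem (isOpen_upperHalf.mem_nhds hq) h)

lemma fderiv_horizontal_of_eq (hν : IsTestDensity ν)
    (h : ∀ q ∈ upperHalf d, f q = c * Kext d b ν q) (hq : q ∈ upperHalf d) (i : Fin d) :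
    fderiv ℝ f q (EuclideanSpace.single i 1, 0) = c * Kext d b (partialDeriv i ν) q := by
  rw [fderiv_eq_of_eqOn_upperHalf h hq, fderiv_const_mul (differentiableAt_Kext b hν hq),
    _root_.smul_apply, fderiv_Kext_horizontal b hν hq, smul_eq_mul]

lemma fderiv_vertical_of_eq (hν : IsTestDensity ν)
    (h : ∀ q ∈ upperHalf d, f q = c * Kext d b ν q) (hq : q ∈ upperHalf d) :
    fderiv ℝ f q (0, 1) = -(c * b) * (q.2 * Kext d (b + 2) ν q) := by
  rw [fderiv_eq_of_eqOn_upperHalf h hq, fderiv_const_mul (differentiableAt_Kext b hν hq),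
    _root_.smul_apply, fderiv_Kext_vertical b hν hq, smul_eq_mul]
  ring

lemma fderiv_vertical_of_eq_snd_mul (hν : IsTestDensity ν)
    (h : ∀ q ∈ upperHalf d, f q = c * (q.2 * Kext d b ν q)) (hq : q ∈ upperHalf d) :
    fderiv ℝ f q (0, 1) = c * (Kext d b ν q - b * (q.2 ^ 2 * Kext d (b + 2) ν q)) := by
  have h1 := differentiableAt_Kext b hν hq
  rw [fderiv_eq_of_eqOn_upperHalf h hq, fderiv_const_mul (differentiableAt_snd.fun_mul h1),
    fderiv_fun_mul differentiableAt_snd h1]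
  simp only [_root_.smul_apply, _root_.add_apply, smul_eq_mul,
    fderiv_Kext_vertical b hν hq, fderiv_snd, ContinuousLinearMap.coe_snd']
  ring

lemma dgamma_of_eq (hν : IsTestDensity ν) (h : ∀ q ∈ upperHalf d, f q = c * Kext d b ν q)
    (hq : q ∈ upperHalf d) :
    dgamma d γ f q = -(c * (b * (d + γ - 1 - b))) * Kext d (b + 2) ν q := by
  have h1 : ∀ i, fderiv ℝ (fun q => fderiv ℝ f q (EuclideanSpace.single i 1, 0)) q
      (EuclideanSpace.single i 1, 0) = c * Kext d b (partialDeriv i (partialDeriv i ν)) q :=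
    fun i => fderiv_horizontal_of_eq (hν.partialDeriv i)
      (fun r hr => fderiv_horizontal_of_eq hν h hr i) hq i
  have h2 : fderiv ℝ (fun q => fderiv ℝ f q (0, 1)) q (0, 1) = _ :=
    fderiv_vertical_of_eq_snd_mul hν (fun r hr => fderiv_vertical_of_eq hν h hr) hq
  have hq' : q.2 ≠ 0 := ne_of_gt hq
  simp only [dgamma, h1, h2, fderiv_vertical_of_eq hν h hq, ← Finset.mul_sum,
    sum_Kext_partialDeriv_partialDeriv_eq b hν hq]
  field_simp
  ring

lemma exists_iterate_dgamma_eq (α : ℝ) (hν : IsTestDensity ν) (ℓ : ℕ) :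
    ∃ c : ℝ, ∀ q ∈ upperHalf d,
      (dgamma d γ)^[ℓ] (Kext d α ν) q = c * Kext d (α + 2 * ℓ) ν q := by
  induction ℓ with
  | zero => exact ⟨1, fun q _ => by simp⟩
  | succ ℓ ih =>
    obtain ⟨c, hc⟩ := ih
    refine ⟨-(c * ((α + 2 * ℓ) * (d + γ - 1 - (α + 2 * ℓ)))), fun q hq => ?_⟩
    rw [Function.iterate_succ_apply', dgamma_of_eq hν hc hq]
    push_cast
    rw [mul_add, mul_one, ← add_assoc]

/-- Iterated partial derivatives along a tuple of coordinate indices. -/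
def iterPartialDeriv {n : ℕ} (J : Fin n → Fin d) (ν : EuclideanSpace ℝ (Fin d) → ℝ) :
    EuclideanSpace ℝ (Fin d) → ℝ :=
  (List.ofFn J).foldr partialDeriv ν

lemma iterPartialDeriv_cons {n : ℕ} (i : Fin d) (J : Fin n → Fin d) :
    iterPartialDeriv (Fin.cons i J : Fin (n + 1) → Fin d) ν =
      partialDeriv i (iterPartialDeriv J ν) := by
  simp [iterPartialDeriv, List.ofFn_succ]

lemma foldr_dX_of_eq (hν : IsTestDensity ν) (h : ∀ q ∈ upperHalf d, f q = c * Kext d b ν q)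
    (L : List (Fin d)) :
    IsTestDensity (L.foldr partialDeriv ν) ∧ ∀ q ∈ upperHalf d,
      L.foldr (fun i h => dX d i h) f q = c * Kext d b (L.foldr partialDeriv ν) q := by
  induction L with
  | nil => exact ⟨hν, h⟩
  | cons i L ih =>
    exact ⟨ih.1.partialDeriv i, fun q hq => fderiv_horizontal_of_eq ih.1 ih.2 hq i⟩

lemma IsTestDensity.iterPartialDeriv (hν : IsTestDensity ν) {n : ℕ} (J : Fin n → Fin d) :
    IsTestDensity (iterPartialDeriv J ν) :=
  (foldr_dX_of_eq (b := 0) (c := 1) hν (fun _ _ => rfl) _).1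

lemma dXIter_of_eq (hν : IsTestDensity ν) (h : ∀ q ∈ upperHalf d, f q = c * Kext d b ν q)
    {n : ℕ} (J : Fin n → Fin d) (hq : q ∈ upperHalf d) :
    dXIter d J f q = c * Kext d b (iterPartialDeriv J ν) q :=
  (foldr_dX_of_eq hν h _).2 q hq

lemma sum_pi_fin_succ {n : ℕ} (F : (Fin (n + 1) → Fin d) → ℝ) :
    ∑ J, F J = ∑ i, ∑ J : Fin n → Fin d, F (Fin.cons i J) := by
  rw [← (Fin.consEquiv fun _ : Fin (n + 1) => Fin d).sum_comp, Fintype.sum_prod_type]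
  rfl

lemma sum_sq_dXIter_add_two (hν : IsTestDensity ν)
    (h : ∀ q ∈ upperHalf d, f q = c * Kext d b ν q) (n : ℕ) (hq : q ∈ upperHalf d) :
    ∑ J : Fin (n + 2) → Fin d, dXIter d J f q ^ 2 =
      c ^ 2 * ∑ J : Fin n → Fin d, hessianDensity d b (iterPartialDeriv J ν) q := by
  simp only [dXIter_of_eq hν h _ hq, sum_pi_fin_succ, iterPartialDeriv_cons, hessianDensity,
    mul_pow, ← Finset.mul_sum]
  exact congrArg _ ((Finset.sum_congr rfl fun i _ => Finset.sum_comm).trans Finset.sum_comm)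

lemma sum_sq_dxi_dXIter_succ (hν : IsTestDensity ν)
    (h : ∀ q ∈ upperHalf d, f q = c * Kext d b ν q) (n : ℕ) (hq : q ∈ upperHalf d) :
    ∑ J : Fin (n + 1) → Fin d, dxi d (dXIter d J f) q ^ 2 =
      c ^ 2 * ∑ J : Fin n → Fin d, crossDensity d b (iterPartialDeriv J ν) q := by
  have h1 : ∀ J : Fin (n + 1) → Fin d, dxi d (dXIter d J f) q = _ := fun J =>
    fderiv_vertical_of_eq (hν.iterPartialDeriv J) (fun r hr => dXIter_of_eq hν h J hr) hq
  simp only [h1, sum_pi_fin_succ, iterPartialDeriv_cons, crossDensity]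
  rw [Finset.sum_comm, Finset.mul_sum]
  refine Finset.sum_congr rfl fun J _ => ?_
  rw [Finset.mul_sum]
  exact Finset.sum_congr rfl fun i _ => by ring

lemma dir_castSucc (i : Fin d) : dir d i.castSucc = (EuclideanSpace.single i 1, 0) := by
  simp [dir]

lemma dir_last : dir d (Fin.last d) = (0, 1) := by
  simp [dir]

lemma sum_sq_dxi_fderiv_dXIter (hν : IsTestDensity ν)
    (h : ∀ q ∈ upperHalf d, f q = c * Kext d b ν q) (n : ℕ) (hq : q ∈ upperHalf d) :
    ∑ i : Fin (d + 1), ∑ J : Fin n → Fin d,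
        dxi d (fun r => fderiv ℝ (dXIter d J f) r (dir d i)) q ^ 2 =
      c ^ 2 * ∑ J : Fin n → Fin d, (crossDensity d b (iterPartialDeriv J ν) q +
        verticalDensity d b (iterPartialDeriv J ν) q) := by
  have h0 := fun (J : Fin n → Fin d) r hr => dXIter_of_eq (q := r) hν h J hr
  have h1 : ∀ (J : Fin n → Fin d) (i : Fin d),
      dxi d (fun r => fderiv ℝ (dXIter d J f) r (EuclideanSpace.single i 1, 0)) q = _ :=
    fun J i => fderiv_vertical_of_eq ((hν.iterPartialDeriv J).partialDeriv i) (fun r hr =>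
      fderiv_horizontal_of_eq (hν.iterPartialDeriv J) (h0 J) hr i) hq
  have h2 : ∀ J : Fin n → Fin d,
      dxi d (fun r => fderiv ℝ (dXIter d J f) r (0, 1)) q = _ :=
    fun J => fderiv_vertical_of_eq_snd_mul (hν.iterPartialDeriv J) (fun r hr =>
      fderiv_vertical_of_eq (hν.iterPartialDeriv J) (h0 J) hr) hq
  simp only [Fin.sum_univ_castSucc, dir_castSucc, dir_last, h1, h2, crossDensity, verticalDensity]
  rw [Finset.sum_comm, ← Finset.sum_add_distrib, Finset.mul_sum]
  refine Finset.sum_congr rfl fun J _ => ?_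
  rw [mul_add, Finset.mul_sum]
  congr 1
  · exact Finset.sum_congr rfl fun i _ => by ring
  · ring

end IteratedDerivatives

end

/-- For `max(0,d-2j-2) < α < d-2j`, `γ = α-d+2j+1`, `μ ∈ C_c^∞(ℝ^d)`,
`𝒦 = 𝒦_{μ,α}`, and integers `p ≥ 2`, `ℓ ≥ 0` with `p + 2ℓ ≤ j+1`:
`∬ ξ^γ |∇_x^p Δ_γ^ℓ 𝒦|² + ∬ ξ^γ |∂_ξ ∇_x^{p-1} Δ_γ^ℓ 𝒦|²
  = (1 - γ/(2j-2ℓ)²) ∬ ξ^γ |∇_x^{p-2} Δ_γ^{ℓ+1} 𝒦|²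
    - ∬ ξ^γ |∂_ξ ∇_{(x,ξ)} ∇_x^{p-2} Δ_γ^ℓ 𝒦|²`. -/
theorem stmt_12 (d j : ℕ) (α γ : ℝ)
    (hα₁ : max 0 ((d : ℝ) - 2 * j - 2) < α) (hα₂ : α < (d : ℝ) - 2 * j)
    (hγ : γ = α - d + 2 * j + 1)
    (μ : EuclideanSpace ℝ (Fin d) → ℝ)
    (hμ : ContDiff ℝ (⊤ : ℕ∞) μ) (hμs : HasCompactSupport μ)
    (p ℓ : ℕ) (hp : 2 ≤ p) (hpl : p + 2 * ℓ ≤ j + 1) :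
    (∫ q in {q : EuclideanSpace ℝ (Fin d) × ℝ | 0 < q.2},
        q.2 ^ γ * ∑ js : Fin p → Fin d,
          (dXIter d js ((dgamma d γ)^[ℓ] (Kext d α μ)) q) ^ 2)
      + (∫ q in {q : EuclideanSpace ℝ (Fin d) × ℝ | 0 < q.2},
          q.2 ^ γ * ∑ js : Fin (p - 1) → Fin d,
            (dxi d (dXIter d js ((dgamma d γ)^[ℓ] (Kext d α μ))) q) ^ 2)
      = (1 - γ / (2 * (j : ℝ) - 2 * (ℓ : ℝ)) ^ 2) *
          (∫ q in {q : EuclideanSpace ℝ (Fin d) × ℝ | 0 < q.2},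
            q.2 ^ γ * ∑ js : Fin (p - 2) → Fin d,
              (dXIter d js ((dgamma d γ)^[ℓ + 1] (Kext d α μ)) q) ^ 2)
        - ∫ q in {q : EuclideanSpace ℝ (Fin d) × ℝ | 0 < q.2},
            q.2 ^ γ * ∑ i : Fin (d + 1), ∑ js : Fin (p - 2) → Fin d,
              (dxi d
                (fun r =>
                  fderiv ℝ (dXIter d js ((dgamma d γ)^[ℓ] (Kext d α μ))) r (dir d i))
                q) ^ 2 := by
  have hν : IsTestDensity μ := ⟨hμ, hμs⟩
  obtain ⟨n, rfl⟩ := Nat.exists_eq_add_of_le' hp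
  obtain ⟨hd, hα⟩ := max_lt_iff.1 hα₁
  have hℓ : (2 : ℝ) + 2 * ℓ ≤ j + 1 := by
    have : 2 + 2 * ℓ ≤ j + 1 := by omega
    exact_mod_cast this
  have hj : (0 : ℝ) ≤ ℓ := Nat.cast_nonneg ℓ
  obtain ⟨c, hc⟩ := exists_iterate_dgamma_eq (γ := γ) α hν ℓ
  have hc' : ∀ q ∈ upperHalf d, (dgamma d γ)^[ℓ + 1] (Kext d α μ) q =
      -(c * ((α + 2 * ℓ) * (2 * j - 2 * ℓ))) * Kext d (α + 2 * ℓ + 2) μ q := fun q hq => by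
    rw [Function.iterate_succ_apply', dgamma_of_eq hν hc hq,
      show (d : ℝ) + γ - 1 - (α + 2 * ℓ) = 2 * j - 2 * ℓ by rw [hγ]; ring]
  have key := integral_sum_density_identity (d := d) (b := α + 2 * ℓ) (γ := γ)
    (ν := fun J : Fin n → Fin d => iterPartialDeriv J μ) (m := 2 * j - 2 * ℓ)
    (by linarith) (by linarith) (by linarith) (fun J => hν.iterPartialDeriv J)
    (by rw [hγ]; ring) (by linarith)
  have e : ∀ {F G : EuclideanSpace ℝ (Fin d) × ℝ → ℝ}, (∀ q ∈ upperHalf d, F q = c ^ 2 * G q) →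
      ∫ q in upperHalf d, q.2 ^ γ * F q = c ^ 2 * ∫ q in upperHalf d, q.2 ^ γ * G q := by
    intro F G h
    rw [← integral_const_mul]
    refine setIntegral_congr_fun measurableSet_upperHalf fun q hq => ?_
    simp only [h q hq]
    ring
  have e1 := e fun q hq => sum_sq_dXIter_add_two hν hc n hq
  have e2 := e fun q hq => sum_sq_dxi_dXIter_succ hν hc n hq
  have e3 := e fun q hq => show ∑ J : Fin n → Fin d,
      dXIter d J ((dgamma d γ)^[ℓ + 1] (Kext d α μ)) q ^ 2 =
      c ^ 2 * ∑ J : Fin n → Fin d, ((α + 2 * ℓ) * (2 * j - 2 * ℓ) *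
        Kext d (α + 2 * ℓ + 2) (iterPartialDeriv J μ) q) ^ 2 by
    simp only [dXIter_of_eq hν hc' _ hq, Finset.mul_sum]
    exact Finset.sum_congr rfl fun J _ => by ring
  have e4 := e fun q hq => sum_sq_dxi_fderiv_dXIter hν hc n hq
  refine (congrArg₂ (· + ·) e1 e2).trans ?_
  refine Eq.trans ?_ (congrArg₂ (fun x y => _ * x - y) e3 e4).symm
  linear_combination c ^ 2 * key
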